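/- arXiv:math/0111174 — 5 statements merged into one kernel-verified Lean document; each statement's English description precedes it below -/
import Mathlib

section
/- Let R be a commutative ring, let φ : R^n → R^n be an R-linear map (a square matrix), and let d ≥ 1. Then det(S^d(φ)) = det(φ)^s where s = binomial(n+d-1, d-1). -/
noncomputable section

/-- The matrix (in the standard bases of monomials) of the `d`-th symmetric power
`S^d(φ) : S^d(R^m) → S^d(R^n)` of the linear map `φ : R^m → R^n` given by the
`n × m` matrix `A`: the `(μ, ν)` entry is the coefficient of the monomial `x^μ` in
`Π_{j ∈ ν} φ(x_j)`, computed in the symmetric algebra `R[x_1, …, x_n]` of `R^n`. -/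
def symPowMatrix {R : Type*} [CommRing R] {m n : ℕ} (d : ℕ) (A : Matrix (Fin n) (Fin m) R) :
    Matrix (Sym (Fin n) d) (Sym (Fin m) d) R := fun μ ν =>
  MvPolynomial.coeff (Multiset.toFinsupp (μ : Multiset (Fin n)))
    (((ν : Multiset (Fin m)).map fun j =>
        ∑ i : Fin n, MvPolynomial.C (A i j) * MvPolynomial.X i).prod)

open MvPolynomial in
/-- The product of the variables indexed by a multiset is the corresponding monomial. -/
theorem prod_map_X_eq_monomial {R σ : Type*} [CommRing R] [DecidableEq σ] (s : Multiset σ) :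
    (s.map (X : σ → MvPolynomial σ R)).prod = monomial (Multiset.toFinsupp s) 1 := by
  induction s using Multiset.induction_on with
  | empty => simp
  | cons a s ih =>
    rw [Multiset.map_cons, Multiset.prod_cons, ih, ← Multiset.singleton_add, map_add,
      Multiset.toFinsupp_singleton, X, monomial_mul, one_mul]

open MvPolynomial in
/-- A homogeneous polynomial of degree `d` is the combination of the monomials of degree `d`
given by its coefficients. -/
theorem MvPolynomial.IsHomogeneous.eq_sum_sym {R σ : Type*} [CommRing R] [Fintype σ]
    [DecidableEq σ] {d : ℕ} {p : MvPolynomial σ R} (hp : p.IsHomogeneous d) :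
    p = ∑ κ : Sym σ d, C (coeff (Multiset.toFinsupp (κ : Multiset σ)) p) *
      ((κ : Multiset σ).map X).prod := by
  ext e
  simp only [prod_map_X_eq_monomial, coeff_sum, coeff_C_mul, coeff_monomial]
  by_cases he : (Finsupp.toMultiset e).card = d
  · rw [Finset.sum_eq_single (Sym.mk (Finsupp.toMultiset e) he)]
    · simp
    · intro κ _ hκ
      rw [if_neg, mul_zero]
      rintro rfl
      exact hκ (Subtype.ext (by simp))
    · simp
  · rw [Finset.sum_eq_zero, hp.coeff_eq_zero]
    · rwa [Finsupp.card_toMultiset] at he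
    · intro κ _
      rw [if_neg, mul_zero]
      rintro rfl
      exact he (by simp)

open MvPolynomial in
theorem isHomogeneous_prod_map_linearForm {R : Type*} [CommRing R] {m n : ℕ}
    (A : Matrix (Fin n) (Fin m) R) (s : Multiset (Fin m)) :
    ((s.map fun j => ∑ i : Fin n, C (A i j) * X i).prod :
      MvPolynomial (Fin n) R).IsHomogeneous s.card := by
  induction s using Multiset.induction_on with
  | empty => simpa using isHomogeneous_one _ _
  | cons a s ih =>
    rw [Multiset.map_cons, Multiset.prod_cons, Multiset.card_cons, add_comm]
    exact (IsHomogeneous.sum _ _ _ fun i _ => isHomogeneous_C_mul_X _ _).mul ih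

open MvPolynomial in
theorem symPowMatrix_mul {R : Type*} [CommRing R] {l m n : ℕ} (d : ℕ)
    (A : Matrix (Fin n) (Fin m) R) (B : Matrix (Fin m) (Fin l) R) :
    symPowMatrix d (A * B) = symPowMatrix d A * symPowMatrix d B := by
  ext μ ν
  have hB := ((ν.2 : Multiset.card (ν : Multiset (Fin l)) = d) ▸
    isHomogeneous_prod_map_linearForm B (ν : Multiset (Fin l))).eq_sum_sym
  have key := congrArg (aeval fun j => (∑ i : Fin n, C (A i j) * X i : MvPolynomial (Fin n) R)) hB
  simp only [map_sum, map_mul, map_multiset_prod, Multiset.map_map, Function.comp_def, aeval_X,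
    algHom_C, algebraMap_eq] at key
  have hform : ∀ j, (∑ i : Fin n, C ((A * B) i j) * X i : MvPolynomial (Fin n) R) =
      ∑ k, C (B k j) * ∑ i, C (A i k) * X i := by
    intro j
    simp only [Matrix.mul_apply, map_sum, map_mul, Finset.sum_mul, Finset.mul_sum]
    rw [Finset.sum_comm]
    exact Finset.sum_congr rfl fun _ _ => Finset.sum_congr rfl fun _ _ => by ring
  rw [symPowMatrix, Matrix.mul_apply]
  simp only [hform]
  rw [key, coeff_sum]
  exact Finset.sum_congr rfl fun _ _ => by rw [coeff_C_mul, mul_comm]; rfl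

open MvPolynomial in
theorem symPowMatrix_map {R S : Type*} [CommRing R] [CommRing S] (f : R →+* S) {m n : ℕ} (d : ℕ)
    (A : Matrix (Fin n) (Fin m) R) :
    symPowMatrix d (A.map f) = (symPowMatrix d A).map f := by
  ext μ ν
  simp [symPowMatrix, ← coeff_map, map_multiset_prod, Multiset.map_map]

open MvPolynomial in
theorem symPowMatrix_diagonal {R : Type*} [CommRing R] {n : ℕ} (d : ℕ) (v : Fin n → R) :
    symPowMatrix d (Matrix.diagonal v) =
      Matrix.diagonal fun ν : Sym (Fin n) d => ((ν : Multiset (Fin n)).map v).prod := by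
  ext μ ν
  have hform : ∀ j, (∑ i : Fin n, C (Matrix.diagonal v i j) * X i : MvPolynomial (Fin n) R) =
      C (v j) * X j := by
    intro j
    rw [Finset.sum_eq_single j] <;> simp +contextual [Matrix.diagonal_apply_ne]
  have hC : ((ν : Multiset (Fin n)).map fun j => (C (v j) : MvPolynomial (Fin n) R)).prod =
      C ((ν : Multiset (Fin n)).map v).prod := by
    simp [map_multiset_prod, Multiset.map_map]
  rw [symPowMatrix, Matrix.diagonal_apply]
  simp only [hform, Multiset.prod_map_mul, hC, prod_map_X_eq_monomial, coeff_C_mul, coeff_monomial,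
    EmbeddingLike.apply_eq_iff_eq, mul_ite, mul_one, mul_zero, Sym.coe_inj]
  by_cases h : μ = ν
  · simp [h]
  · rw [if_neg h, if_neg (Ne.symm h)]

theorem symPowMatrix_one {R : Type*} [CommRing R] {n : ℕ} (d : ℕ) :
    symPowMatrix d (1 : Matrix (Fin n) (Fin n) R) = 1 := by
  rw [← Matrix.diagonal_one, symPowMatrix_diagonal]
  simp

/-- The total multiplicity of a fixed element in all multisets of cardinality `d`. -/
theorem Sym.sum_count {n : ℕ} {d : ℕ} (hd : 1 ≤ d) (j : Fin n) :
    ∑ ν : Sym (Fin n) d, (ν : Multiset (Fin n)).count j = (n + d - 1).choose (d - 1) := by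
  have hsymm : ∀ i, ∑ ν : Sym (Fin n) d, (ν : Multiset (Fin n)).count i =
      ∑ ν : Sym (Fin n) d, (ν : Multiset (Fin n)).count j := by
    intro i
    refine Fintype.sum_equiv (Sym.equivCongr (Equiv.swap i j)) _ _ fun ν => ?_
    have := Multiset.count_map_eq_count' (Equiv.swap i j) (ν : Multiset (Fin n))
      (Equiv.injective _) i
    rw [Equiv.swap_apply_left] at this
    exact this.symm
  have htotal : ∑ i : Fin n, ∑ ν : Sym (Fin n) d, (ν : Multiset (Fin n)).count i =
      (n + d - 1).choose d * d := by
    rw [Finset.sum_comm]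
    simp [Multiset.sum_count_eq_card, Sym.card_sym_eq_choose]
  obtain ⟨k, rfl⟩ := Nat.exists_eq_add_of_le' hd
  have hn : 0 < n := j.pos
  rw [Finset.sum_congr rfl fun i _ => hsymm i, Finset.sum_const, Finset.card_univ,
    Fintype.card_fin, smul_eq_mul, Nat.choose_succ_right_eq,
    show n + (k + 1) - 1 - k = n by lia, mul_comm] at htotal
  exact Nat.eq_of_mul_eq_mul_right hn htotal

theorem det_symPowMatrix_diagonal {R : Type*} [CommRing R] {n d : ℕ} (hd : 1 ≤ d)
    (v : Fin n → R) :
    (symPowMatrix d (Matrix.diagonal v)).det =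
      (Matrix.diagonal v).det ^ ((n + d - 1).choose (d - 1)) := by
  rw [symPowMatrix_diagonal, Matrix.det_diagonal, Matrix.det_diagonal, ← Finset.prod_pow]
  simp only [Finset.prod_multiset_map_count]
  have : ∀ ν : Sym (Fin n) d, ∏ j ∈ (ν : Multiset (Fin n)).toFinset,
      v j ^ (ν : Multiset (Fin n)).count j = ∏ j, v j ^ (ν : Multiset (Fin n)).count j :=
    fun ν => Finset.prod_subset (Finset.subset_univ _) fun j _ hj => by
      rw [Multiset.mem_toFinset] at hj
      rw [Multiset.count_eq_zero_of_notMem hj, pow_zero]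
  simp only [this]
  rw [Finset.prod_comm]
  simp only [Finset.prod_pow_eq_pow_sum, Sym.sum_count hd]

/-- Conjugating a transvection by the diagonal matrix with a `2` in position `i` squares it, so
the multiplicative function `det ∘ S^d` takes the value `1` on it. -/
theorem det_symPowMatrix_transvection {K : Type*} [Field K] [CharZero K] {n d : ℕ} (hd : 1 ≤ d)
    {i j : Fin n} (hij : i ≠ j) (c : K) :
    (symPowMatrix d (Matrix.transvection i j c)).det = 1 := by
  set D : Matrix (Fin n) (Fin n) K := Matrix.diagonal (Function.update 1 i 2)
  set T := Matrix.transvection i j c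
  have hD : (symPowMatrix d D).det ≠ 0 := by
    rw [det_symPowMatrix_diagonal hd, Matrix.det_diagonal]
    refine pow_ne_zero _ (Finset.prod_ne_zero_iff.2 fun k _ => ?_)
    by_cases hk : k = i
    · subst hk; simp
    · simp [hk]
  have hT : (symPowMatrix d T).det ≠ 0 := by
    have h : T * Matrix.transvection i j (-c) = 1 := by
      rw [Matrix.transvection_mul_transvection_same _ _ hij, add_neg_cancel,
        Matrix.transvection_zero]
    have := congrArg (fun M => (symPowMatrix d M).det) h
    simp only [symPowMatrix_mul, Matrix.det_mul, symPowMatrix_one, Matrix.det_one] at this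
    exact left_ne_zero_of_mul_eq_one this
  have hcomm : D * T = T * T * D := by
    rw [Matrix.transvection_mul_transvection_same _ _ hij]
    ext a b
    simp only [D, T, Matrix.transvection, Matrix.diagonal_mul, Matrix.mul_diagonal,
      Matrix.add_apply, Matrix.one_apply, Matrix.single_apply, Function.update_apply, Pi.one_apply]
    grind
  have := congrArg (fun M => (symPowMatrix d M).det) hcomm
  simp only [symPowMatrix_mul, Matrix.det_mul] at this
  rw [mul_comm] at this
  exact (mul_right_cancel₀ hT ((one_mul _).trans (mul_right_cancel₀ hD this))).symm

theorem det_symPowMatrix_of_charZero {K : Type*} [Field K] [CharZero K] {n d : ℕ} (hd : 1 ≤ d)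
    (A : Matrix (Fin n) (Fin n) K) :
    (symPowMatrix d A).det = A.det ^ ((n + d - 1).choose (d - 1)) := by
  refine Matrix.diagonal_transvection_induction
    (fun A => (symPowMatrix d A).det = A.det ^ ((n + d - 1).choose (d - 1))) A
    (fun v _ => det_symPowMatrix_diagonal hd v) (fun t => ?_) fun A B hA hB => ?_
  · rw [Matrix.TransvectionStruct.det, one_pow]
    exact det_symPowMatrix_transvection hd t.hij t.c
  · rw [symPowMatrix_mul, Matrix.det_mul, hA, hB, Matrix.det_mul, mul_pow]

/-- For a square matrix `φ : R^n → R^n` over a commutative ring and `d ≥ 1`,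
`det (S^d(φ)) = det(φ) ^ ((n + d - 1).choose (d - 1))`. -/
theorem det_symPow {R : Type*} [CommRing R] {n : ℕ} (φ : Matrix (Fin n) (Fin n) R)
    (d : ℕ) (hd : 1 ≤ d) :
    (symPowMatrix d φ).det = φ.det ^ ((n + d - 1).choose (d - 1)) := by
  let P := MvPolynomial (Fin n × Fin n) ℤ
  let G : Matrix (Fin n) (Fin n) P := Matrix.mvPolynomialX (Fin n) (Fin n) ℤ
  have hgeneric : (symPowMatrix d G).det = G.det ^ ((n + d - 1).choose (d - 1)) := by
    have : CharZero (FractionRing P) :=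
      charZero_of_injective_algebraMap (IsFractionRing.injective P (FractionRing P))
    apply IsFractionRing.injective P (FractionRing P)
    rw [map_pow, RingHom.map_det, RingHom.map_det, RingHom.mapMatrix_apply,
      RingHom.mapMatrix_apply, ← symPowMatrix_map]
    exact det_symPowMatrix_of_charZero hd _
  let f : P →+* R := MvPolynomial.eval₂Hom (Int.castRingHom R) fun p => φ p.1 p.2
  have hG : G.map f = φ := by
    ext i j
    exact (MvPolynomial.eval₂Hom_X' _ _ _)
  have := congrArg f hgeneric
  rwa [map_pow, RingHom.map_det, RingHom.map_det, RingHom.mapMatrix_apply,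
    RingHom.mapMatrix_apply, ← symPowMatrix_map, hG] at this
end
end

section
/- Let R be a commutative ring, let φ : R^m → R^n be an R-linear map, and let d ≥ 1. Then I(S^d(φ)) ⊆ I(φ)^s, where s = binomial(n+d-1, d-1). -/
noncomputable section

/-- `I_t(A)`: the ideal of `R` generated by the `t × t` minors of the matrix `A`. -/
def minorsIdeal {R : Type*} [CommRing R] (t : ℕ) {N M : Type*} (A : Matrix N M R) : Ideal R :=
  Ideal.span {x : R | ∃ (r : Fin t → N) (c : Fin t → M), x = (A.submatrix r c).det}

section Words

variable {P α : Type*} [DecidableEq P] [DecidableEq α]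

/-- The sum of `h` over all words obtained from `u` by replacing one letter `b`, at a position in
`S`, by the letter `a`. -/
def replaceSum (S : Finset P) (b a : α) (h : (P → α) → ℤ) (u : P → α) : ℤ :=
  ∑ p ∈ S, if u p = b then h (Function.update u p a) else 0

theorem sum_mul_replaceSum [Fintype P] [Fintype α] (S : Finset P) (b a : α) (g h : (P → α) → ℤ) :
    ∑ u, g u * replaceSum S b a h u = ∑ u, replaceSum S a b g u * h u := by
  simp only [replaceSum, Finset.mul_sum, Finset.sum_mul]
  rw [Finset.sum_comm, Finset.sum_comm (s := Finset.univ)]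
  refine Finset.sum_congr rfl fun p _ => ?_
  simp only [mul_ite, ite_mul, mul_zero, zero_mul, ← Finset.sum_filter]
  refine Finset.sum_nbij' (fun u => Function.update u p a) (fun u => Function.update u p b)
    (by simp) (by simp) ?_ ?_ ?_
  · intro u hu
    simp only [Finset.mem_filter, Finset.mem_univ, true_and] at hu
    simp [← hu]
  · intro u hu
    simp only [Finset.mem_filter, Finset.mem_univ, true_and] at hu
    simp [← hu]
  · intro u hu
    simp only [Finset.mem_filter, Finset.mem_univ, true_and] at hu
    simp [← hu]

theorem replaceSum_replaceSum (S : Finset P) (a b : α) (h : (P → α) → ℤ)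
    (u : P → α) :
    replaceSum S b a (replaceSum S a b h) u =
      (∑ p ∈ S, ∑ q ∈ S, if p ≠ q ∧ u p = b ∧ u q = a then
        h (Function.update (Function.update u p a) q b) else 0) +
      (S.filter fun p => u p = b).card * h u := by
  have key : ∀ p ∈ S, (if u p = b then replaceSum S a b h (Function.update u p a) else 0) =
      (∑ q ∈ S, if p ≠ q ∧ u p = b ∧ u q = a then
        h (Function.update (Function.update u p a) q b) else 0) +
      if u p = b then h u else 0 := by
    intro p hp
    by_cases hb : u p = b
    · simp only [hb, if_true, replaceSum]
      rw [← Finset.add_sum_erase S _ hp, ← Finset.add_sum_erase S _ hp]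
      simp only [Function.update_self, Function.update_idem, ne_eq, not_true_eq_false, false_and,
        if_false, if_true, zero_add]
      rw [add_comm, ← hb, Function.update_eq_self]
      congr 1
      refine Finset.sum_congr rfl fun q hq => ?_
      have hqp := Finset.ne_of_mem_erase hq
      simp [hqp, Ne.symm hqp]
    · simp [hb]
  rw [replaceSum, Finset.sum_congr rfl key, Finset.sum_add_distrib,
    ← Finset.sum_filter _ (fun _ => h u)]
  simp

theorem replaceSum_comm (S : Finset P) (a b : α) (h : (P → α) → ℤ) (u : P → α) :
    replaceSum S b a (replaceSum S a b h) u =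
      replaceSum S a b (replaceSum S b a h) u +
      ((S.filter fun p => u p = b).card - (S.filter fun p => u p = a).card : ℤ) * h u := by
  rw [replaceSum_replaceSum S a b, replaceSum_replaceSum S b a, Finset.sum_comm]
  have : ∀ p ∈ S, ∀ q ∈ S, (if q ≠ p ∧ u q = b ∧ u p = a then
        h (Function.update (Function.update u q a) p b) else 0) =
      if p ≠ q ∧ u p = a ∧ u q = b then
        h (Function.update (Function.update u p b) q a) else 0 := by
    intro p _ q _
    by_cases hpq : p = q
    · simp [hpq]
    · simp only [ne_eq, hpq, Ne.symm hpq, not_false_eq_true, true_and, and_comm,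
        Function.update_comm hpq]
  rw [Finset.sum_congr rfl fun p hp => Finset.sum_congr rfl (this p hp)]
  ring

/-- A nonzero highest weight vector has dominant weight. -/
theorem card_le_card_of_replaceSum_eq_zero [Fintype P] [Fintype α] (S : Finset P) {a b : α}
    (h : (P → α) → ℤ) (hS : ∀ u, replaceSum S b a h u = 0) {A B : ℕ}
    (hA : ∀ u, h u ≠ 0 → (S.filter fun p => u p = a).card = A)
    (hB : ∀ u, h u ≠ 0 → (S.filter fun p => u p = b).card = B) {w : P → α} (hw : h w ≠ 0) :
    A ≤ B := by
  have h1 : ∑ u, replaceSum S a b h u * replaceSum S a b h u =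
      ((B : ℤ) - A) * ∑ u, h u * h u := by
    rw [← sum_mul_replaceSum, Finset.mul_sum]
    refine Finset.sum_congr rfl fun u _ => ?_
    by_cases hu : h u = 0
    · simp [hu]
    · rw [replaceSum_comm S a b, hA u hu, hB u hu]
      have : replaceSum S a b (replaceSum S b a h) u = 0 := by
        simp [replaceSum.eq_def S a b, hS]
      rw [this]
      ring
  have h2 : 0 ≤ ∑ u, replaceSum S a b h u * replaceSum S a b h u :=
    Finset.sum_nonneg fun u _ => mul_self_nonneg _
  have h3 : 0 < ∑ u, h u * h u :=
    Finset.sum_pos' (fun u _ => mul_self_nonneg _)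
      ⟨w, Finset.mem_univ _, mul_self_pos.2 hw⟩
  rw [h1] at h2
  have := nonneg_of_mul_nonneg_left h2 h3
  omega

end Words

section Lead

variable {r n : ℕ}

/-- The coefficient functions of multilinear forms in `r` vectors of `ℤ^n` that are annihilated by
all off-diagonal matrices and have weight `(s, …, s)`. -/
structure IsDetWeight (s : ℕ) (c : (Fin r → Fin n) → ℤ) : Prop where
  replaceSum_eq_zero : ∀ a b, a ≠ b → ∀ u, replaceSum Finset.univ b a c u = 0
  card_eq : ∀ u, c u ≠ 0 → ∀ i, (Finset.univ.filter fun p => u p = i).card = s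

theorem IsDetWeight.card_suffix_le {s : ℕ} {c : (Fin r → Fin n) → ℤ} (hc : IsDetWeight s c)
    {w : Fin r → Fin n} (hw : c w ≠ 0) (hmin : ∀ u, c u ≠ 0 → toLex w ≤ toLex u)
    {a b : Fin n} (hab : a < b) (q : Fin r) :
    (Finset.univ.filter fun p => q < p ∧ w p = a).card ≤
      (Finset.univ.filter fun p => q < p ∧ w p = b).card := by
  set S : Finset (Fin r) := Finset.univ.filter fun p => q < p with hS
  have hupd : ∀ (u : Fin r → Fin n), ∀ p ∈ S,
      ((∀ x ≤ q, Function.update u p a x = w x) ↔ ∀ x ≤ q, u x = w x) := by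
    intro u p hp
    refine forall₂_congr fun x hx => ?_
    rw [Function.update_of_ne]
    rintro rfl
    simp [hS] at hp
    omega
  have hcard : ∀ (i : Fin n) (u : Fin r → Fin n),
      (if ∀ x ≤ q, u x = w x then c u else 0) ≠ 0 →
      (S.filter fun p => u p = i).card = (S.filter fun p => w p = i).card := by
    intro i u hu
    obtain ⟨h1, h2⟩ := ite_ne_right_iff.1 hu
    have e1 := hc.card_eq u h2 i
    have e2 := hc.card_eq w hw i
    rw [← Finset.card_filter_add_card_filter_not (s := Finset.univ.filter fun p => u p = i)
      (fun p => q < p)] at e1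
    rw [← Finset.card_filter_add_card_filter_not (s := Finset.univ.filter fun p => w p = i)
      (fun p => q < p)] at e2
    have e3 : ((Finset.univ.filter fun p => u p = i).filter fun p => ¬ q < p) =
        (Finset.univ.filter fun p => w p = i).filter fun p => ¬ q < p := by
      ext p
      simp only [Finset.mem_filter, Finset.mem_univ, true_and, not_lt]
      constructor
      · rintro ⟨h, h'⟩
        exact ⟨h1 p h' ▸ h, h'⟩
      · rintro ⟨h, h'⟩
        exact ⟨(h1 p h').trans h, h'⟩
    rw [e3] at e1
    rw [hS, Finset.filter_comm (fun p => q < p) (fun p => u p = i),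
      Finset.filter_comm (fun p => q < p) (fun p => w p = i)]
    omega
  have := card_le_card_of_replaceSum_eq_zero S
    (fun u => if ∀ x ≤ q, u x = w x then c u else 0) ?_ (hcard a) (hcard b) (w := w) (by simpa)
  · simpa [hS, Finset.filter_filter] using this
  intro u
  by_cases hu : ∀ x ≤ q, u x = w x
  · have h0 := hc.replaceSum_eq_zero a b hab.ne u
    rw [replaceSum, ← Finset.sum_subset (Finset.subset_univ S)] at h0
    · rw [← h0, replaceSum]
      refine Finset.sum_congr rfl fun p hp => ?_
      rw [if_pos ((hupd u p hp).2 hu)]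
    · intro p _ hp
      have hpq : p ≤ q := by simpa [hS] using hp
      rw [ite_eq_right_iff]
      intro hb
      by_contra hne
      refine (hmin _ hne).not_gt ⟨p, fun x hx => ?_, ?_⟩
      · simpa [Function.update_of_ne hx.ne] using hu x (hx.le.trans hpq)
      · simpa [← hu p hpq, hb] using hab
  · refine Finset.sum_eq_zero fun p hp => ?_
    dsimp only
    rw [if_neg (mt (hupd u p hp).1 hu), ite_self]

theorem IsDetWeight.exists_equiv {s : ℕ} {c : (Fin r → Fin n) → ℤ} (hc : IsDetWeight s c)
    {w : Fin r → Fin n} (hw : c w ≠ 0) (hmin : ∀ u, c u ≠ 0 → toLex w ≤ toLex u) :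
    ∃ e : Fin n × Fin s ≃ Fin r, (∀ i k, w (e (i, k)) = i) ∧
      ∀ k, StrictMono fun i => e (i, k) := by
  have hcw := hc.card_eq w hw
  let rank : Fin r → ℕ := fun p => (Finset.univ.filter fun x => x < p ∧ w x = w p).card
  have hrank : ∀ p, rank p < s := by
    intro p
    rw [← hcw (w p)]
    refine Finset.card_lt_card ⟨fun x hx => ?_, fun h => ?_⟩
    · simp only [Finset.mem_filter, Finset.mem_univ, true_and] at hx ⊢
      exact hx.2
    · have := h (x := p) (by simp)
      simp at this
  have hmono : ∀ p q, w p = w q → p < q → rank p < rank q := by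
    intro p q hpq hlt
    refine Finset.card_lt_card ⟨fun x hx => ?_, fun h => ?_⟩
    · simp only [Finset.mem_filter, Finset.mem_univ, true_and] at hx ⊢
      exact ⟨hx.1.trans hlt, hx.2.trans hpq⟩
    · have := h (x := p) (by simp [hlt, hpq])
      simp at this
  let f : Fin r → Fin n × Fin s := fun p => (w p, ⟨rank p, hrank p⟩)
  have hinj : Function.Injective f := by
    intro p q hpq
    simp only [f, Prod.mk.injEq, Fin.mk.injEq] at hpq
    rcases lt_trichotomy p q with h | h | h
    · exact absurd hpq.2 (hmono p q hpq.1 h).ne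
    · exact h
    · exact absurd hpq.2 (hmono q p hpq.1.symm h).ne'
  have hcardr : Fintype.card (Fin r) = Fintype.card (Fin n × Fin s) := by
    have := Finset.card_eq_sum_card_fiberwise (f := w) (s := Finset.univ) (t := Finset.univ)
      (fun _ _ => Finset.mem_coe.2 (Finset.mem_univ _))
    simpa [hcw] using this
  let e := Equiv.ofBijective f ((Fintype.bijective_iff_injective_and_card f).2 ⟨hinj, hcardr⟩)
  have he : ∀ i k, w (e.symm (i, k)) = i ∧ rank (e.symm (i, k)) = k := by
    intro i k
    have : f (e.symm (i, k)) = (i, k) := e.apply_symm_apply (i, k)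
    simp only [f, Prod.mk.injEq, Fin.ext_iff] at this
    exact ⟨Fin.ext this.1, this.2⟩
  refine ⟨e.symm, fun i k => (he i k).1, fun k i j hij => ?_⟩
  obtain ⟨hi, hik⟩ := he i k
  obtain ⟨hj, hjk⟩ := he j k
  change e.symm (i, k) < e.symm (j, k)
  generalize e.symm (i, k) = p at *
  generalize e.symm (j, k) = q at *
  by_contra hlt
  have hqp : q < p := lt_of_le_of_ne (not_lt.1 hlt) (by rintro rfl; exact hij.ne (hi.symm.trans hj))
  have hle := hc.card_suffix_le hw hmin hij q
  have e1 := hcw i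
  have e2 := hcw j
  rw [← Finset.card_filter_add_card_filter_not (fun x => q < x), Finset.filter_filter,
    Finset.filter_filter] at e1 e2
  simp only [and_comm] at hle e1 e2
  have h1 : (Finset.univ.filter fun x => ¬ q < x ∧ w x = i).card ≤ rank p := by
    refine Finset.card_le_card fun x hx => ?_
    simp only [Finset.mem_filter, Finset.mem_univ, true_and, not_lt] at hx ⊢
    exact ⟨hx.1.trans_lt hqp, hx.2.trans hi.symm⟩
  have h2 : rank q < (Finset.univ.filter fun x => ¬ q < x ∧ w x = j).card := by
    refine Finset.card_lt_card ⟨fun x hx => ?_, fun h => ?_⟩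
    · simp only [Finset.mem_filter, Finset.mem_univ, true_and, not_lt] at hx ⊢
      exact ⟨hx.1.le, hx.2.trans hj⟩
    · have := h (x := q) (by simp [hj])
      simp at this
  simp only [and_comm] at h1 h2
  omega

end Lead

section Bracket

/-- Replacing one column `v` at a time by `T v` is the derivation of the determinant whose value
is multiplication by the trace of `T`. -/
theorem Matrix.sum_det_updateCol_mul {ι R : Type*} [Fintype ι] [DecidableEq ι] [CommRing R]
    (T M : Matrix ι ι R) :
    ∑ k, (M.updateCol k fun i => (T * M) i k).det = T.trace * M.det := by
  have : ∀ k, (M.updateCol k fun i => (T * M) i k).det = (M.adjugate * (T * M)) k k := by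
    intro k
    rw [← Matrix.cramer_apply, Matrix.cramer_eq_adjugate_mulVec]
    rfl
  simp_rw [this]
  change (M.adjugate * (T * M)).trace = _
  rw [Matrix.trace_mul_comm, Matrix.mul_assoc, Matrix.mul_adjugate, Matrix.mul_smul, Matrix.mul_one,
    Matrix.trace_smul, smul_eq_mul, mul_comm]

/-- The `0`-`1` matrix whose `i`-th column is the basis vector of index `v i`. -/
def letterMatrix {n : ℕ} (v : Fin n → Fin n) : Matrix (Fin n) (Fin n) ℤ :=
  Matrix.of fun j i => if v i = j then 1 else 0

theorem letterMatrix_id (n : ℕ) : letterMatrix (fun i : Fin n => i) = 1 := by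
  ext i j
  simp [letterMatrix, Matrix.one_apply, eq_comm]

theorem injective_of_det_letterMatrix_ne_zero {n : ℕ} {v : Fin n → Fin n}
    (h : (letterMatrix v).det ≠ 0) : Function.Injective v := by
  intro i j hij
  by_contra hne
  exact h (Matrix.det_zero_of_column_eq hne fun k => by simp [letterMatrix, hij])

theorem replaceSum_det_letterMatrix {n : ℕ} {a b : Fin n} (hab : a ≠ b) (v : Fin n → Fin n) :
    replaceSum Finset.univ b a (fun v => (letterMatrix v).det) v = 0 := by
  have := Matrix.sum_det_updateCol_mul (Matrix.single a b (1 : ℤ)) (letterMatrix v)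
  rw [Matrix.trace_single_eq_of_ne _ _ _ hab, zero_mul] at this
  rw [← this, replaceSum]
  refine Finset.sum_congr rfl fun i _ => ?_
  split_ifs with hi
  · congr 1
    ext j k
    by_cases hk : k = i
    · subst hk
      by_cases hj : a = j
      · subst hj
        simp [letterMatrix, hi]
      · simp [letterMatrix, hj, Matrix.single_mul_apply_of_ne _ _ _ _ _ (Ne.symm hj)]
    · simp [letterMatrix, hk]
  · symm
    refine Matrix.det_eq_zero_of_column_eq_zero i fun j => ?_
    by_cases hj : a = j
    · subst hj
      simp [letterMatrix, hi]
    · simp [Matrix.single_mul_apply_of_ne _ _ _ _ _ (Ne.symm hj)]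

variable {r n s : ℕ}

/-- The coefficient function of the product of the `s` determinants formed from the vectors at the
positions `e (·, k)`. -/
def bracketProd (e : Fin n × Fin s ≃ Fin r) (u : Fin r → Fin n) : ℤ :=
  ∏ k, (letterMatrix fun i => u (e (i, k))).det

theorem injective_of_bracketProd_ne_zero {e : Fin n × Fin s ≃ Fin r} {u : Fin r → Fin n}
    (h : bracketProd e u ≠ 0) (k : Fin s) : Function.Injective fun i => u (e (i, k)) :=
  injective_of_det_letterMatrix_ne_zero (Finset.prod_ne_zero_iff.1 h k (Finset.mem_univ k))

theorem isDetWeight_bracketProd (e : Fin n × Fin s ≃ Fin r) : IsDetWeight s (bracketProd e) where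
  replaceSum_eq_zero a b hab u := by
    rw [replaceSum, ← e.sum_comp, Fintype.sum_prod_type_right]
    refine Finset.sum_eq_zero fun k _ => ?_
    have h0 := replaceSum_det_letterMatrix hab fun i => u (e (i, k))
    refine Eq.trans ?_ ((congrArg ((∏ l ∈ Finset.univ.erase k,
      (letterMatrix fun i => u (e (i, l))).det) * ·) h0).trans (mul_zero _))
    rw [replaceSum, Finset.mul_sum]
    refine Finset.sum_congr rfl fun i _ => ?_
    rw [mul_ite, mul_zero]
    congr 1
    rw [bracketProd, ← Finset.prod_erase_mul _ _ (Finset.mem_univ k)]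
    congr 1
    · refine Finset.prod_congr rfl fun l hl => ?_
      congr 2
      ext j : 1
      rw [Function.update_of_ne]
      simp [Finset.ne_of_mem_erase hl]
    · congr 2
      ext j : 1
      simp [Function.update_apply]
  card_eq u hu i := by
    rw [Finset.card_filter, ← e.sum_comp, Fintype.sum_prod_type_right]
    have : ∀ k : Fin s, (∑ j, if u (e (j, k)) = i then 1 else 0) = 1 := by
      intro k
      have hb := Finite.injective_iff_bijective.1 (injective_of_bracketProd_ne_zero hu k)
      rw [hb.sum_comp fun j => if j = i then 1 else 0]
      simp
    simp [this]

theorem bracketProd_eq_one {e : Fin n × Fin s ≃ Fin r} {w : Fin r → Fin n}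
    (hw : ∀ i k, w (e (i, k)) = i) : bracketProd e w = 1 := by
  simp [bracketProd, hw, letterMatrix_id]

theorem toLex_le_of_bracketProd_ne_zero {e : Fin n × Fin s ≃ Fin r} {w u : Fin r → Fin n}
    (hw : ∀ i k, w (e (i, k)) = i) (he : ∀ k, StrictMono fun i => e (i, k))
    (hu : bracketProd e u ≠ 0) : toLex w ≤ toLex u := by
  by_contra hlt
  obtain ⟨p, hp, hlt⟩ := not_le.1 hlt
  obtain ⟨⟨i, k⟩, rfl⟩ := e.surjective p
  change u (e (i, k)) < w (e (i, k)) at hlt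
  rw [hw] at hlt
  have h1 : u (e (u (e (i, k)), k)) = w (e (u (e (i, k)), k)) := hp _ (he k hlt)
  rw [hw] at h1
  exact hlt.ne (injective_of_bracketProd_ne_zero hu k h1)

theorem Matrix.det_sum_smul {ι κ R : Type*} [Fintype ι] [DecidableEq ι] [Fintype κ] [CommRing R]
    (a : ι → κ → R) (g : κ → ι → R) :
    (Matrix.of fun j i => ∑ y, a i y * g y j).det =
      ∑ v : ι → κ, (∏ i, a i (v i)) * (Matrix.of fun j i => g (v i) j).det := by
  classical
  rw [← Matrix.det_transpose]
  have : (Matrix.of fun j i => ∑ y, a i y * g y j).transpose = fun i => ∑ y, a i y • g y := by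
    ext i j
    simp
  rw [this]
  change Matrix.detRowAlternating.toMultilinearMap _ = _
  rw [MultilinearMap.map_sum]
  refine Finset.sum_congr rfl fun v _ => ?_
  rw [MultilinearMap.map_smul_univ, smul_eq_mul, ← Matrix.det_transpose (Matrix.of _)]
  rfl

theorem Matrix.det_eq_sum_letterMatrix {R : Type*} [CommRing R] (B : Matrix (Fin n) (Fin n) R) :
    B.det = ∑ v : Fin n → Fin n, ((letterMatrix v).det : R) * ∏ i, B (v i) i := by
  have h := Matrix.det_sum_smul (fun i y => B y i) fun y j : Fin n => if y = j then (1 : R) else 0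
  have hB : (Matrix.of fun j i => ∑ y, B y i * if y = j then (1 : R) else 0) = B := by
    ext j i
    simp
  rw [hB] at h
  rw [h]
  refine Finset.sum_congr rfl fun v _ => ?_
  rw [Int.cast_det, mul_comm]
  congr 2
  ext j i
  simp [letterMatrix]

theorem sum_bracketProd_mul {R : Type*} [CommRing R] (e : Fin n × Fin s ≃ Fin r)
    (A : Matrix (Fin n) (Fin r) R) :
    ∑ u, (bracketProd e u : R) * ∏ p, A (u p) p =
      ∏ k, (A.submatrix id fun i => e (i, k)).det := by
  rw [Finset.prod_congr rfl fun k _ => Matrix.det_eq_sum_letterMatrix _, Finset.prod_univ_sum,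
    Fintype.piFinset_univ]
  let E : (Fin r → Fin n) ≃ (Fin s → Fin n → Fin n) :=
    (e.symm.arrowCongr (Equiv.refl _)).trans
      (((Equiv.prodComm _ _).arrowCongr (Equiv.refl _)).trans (Equiv.curry _ _ _))
  refine Fintype.sum_equiv E _ _ fun u => ?_
  rw [Finset.prod_mul_distrib, bracketProd, Int.cast_prod, ← e.prod_comp,
    Fintype.prod_prod_type_right]
  rfl

/-- Integral first fundamental theorem for multilinear forms, in ideal form. -/
theorem IsDetWeight.sum_mul_prod_mem {R : Type*} [CommRing R] {I : Ideal R}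
    (A : Matrix (Fin n) (Fin r) R) (hI : ∀ f : Fin n → Fin r, (A.submatrix id f).det ∈ I)
    {c : (Fin r → Fin n) → ℤ} (hc : IsDetWeight s c) :
    ∑ u, (c u : R) * ∏ p, A (u p) p ∈ I ^ s := by
  induction hN : (Finset.univ.filter fun u => ∃ v, c v ≠ 0 ∧ toLex v ≤ toLex u).card
    using Nat.strong_induction_on generalizing c with
  | _ N ih =>
  by_cases h0 : ∃ u, c u ≠ 0
  · obtain ⟨w, hw, hmin⟩ := Set.exists_min_image {u | c u ≠ 0} toLex (Set.toFinite _) h0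
    obtain ⟨e, hew, hmono⟩ := hc.exists_equiv hw hmin
    have hD := isDetWeight_bracketProd e
    have hDmin : ∀ u, bracketProd e u ≠ 0 → toLex w ≤ toLex u := fun u hu =>
      toLex_le_of_bracketProd_ne_zero hew hmono hu
    have hsub : ∀ u, c u - c w * bracketProd e u ≠ 0 → c u ≠ 0 ∨ bracketProd e u ≠ 0 := by
      intro u hu
      by_contra! h
      simp [h.1, h.2] at hu
    have hc' : IsDetWeight s fun u => c u - c w * bracketProd e u := by
      refine ⟨fun a b hab u => ?_, fun u hu => ?_⟩
      · have h1 := hc.replaceSum_eq_zero a b hab u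
        have h2 := hD.replaceSum_eq_zero a b hab u
        rw [← sub_zero (0 : ℤ)]
        nth_rw 1 [← h1]
        rw [← mul_zero (c w), ← h2]
        simp only [replaceSum, Finset.mul_sum, ← Finset.sum_sub_distrib]
        refine Finset.sum_congr rfl fun p _ => ?_
        split_ifs <;> simp
      · exact (hsub u hu).elim (hc.card_eq u) (hD.card_eq u)
    have hmem := ih _ ?_ hc' rfl
    · have hDmem : ∑ u, (bracketProd e u : R) * ∏ p, A (u p) p ∈ I ^ s := by
        rw [sum_bracketProd_mul]
        have := Ideal.prod_mem_prod (s := Finset.univ) (I := fun _ : Fin s => I)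
          (x := fun k => (A.submatrix id fun i => e (i, k)).det) fun k _ => hI _
        simpa using this
      have := add_mem hmem (Ideal.mul_mem_left _ (c w : R) hDmem)
      convert this using 1
      rw [Finset.mul_sum, ← Finset.sum_add_distrib]
      refine Finset.sum_congr rfl fun u _ => ?_
      push_cast
      ring
    · rw [← hN]
      refine Finset.card_lt_card ((Finset.ssubset_iff_of_subset ?_).2 ⟨w, ?_, ?_⟩)
      · intro u hu
        simp only [Finset.mem_filter, Finset.mem_univ, true_and] at hu ⊢
        obtain ⟨v, hv, hvu⟩ := hu
        exact ⟨w, hw, ((hsub v hv).elim (hmin v) (hDmin v)).trans hvu⟩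
      · simp only [Finset.mem_filter, Finset.mem_univ, true_and]
        exact ⟨w, hw, le_rfl⟩
      · simp only [Finset.mem_filter, Finset.mem_univ, true_and, not_exists, not_and]
        intro v hv hvw
        have : v = w := toLex.injective (hvw.antisymm ((hsub v hv).elim (hmin v) (hDmin v)))
        subst this
        simp [bracketProd_eq_one hew] at hv
  · push Not at h0
    simp [h0]

end Bracket

section SymPow

variable {m n N d : ℕ}

/-- The multiset of letters of a word. -/
def wordSym {α : Type*} (v : Fin d → α) : Sym α d :=
  ⟨Finset.univ.val.map v, by simp⟩

theorem wordSym_surjective {α : Type*} (ν : Sym α d) : ∃ f : Fin d → α, wordSym f = ν := by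
  obtain ⟨⟨l⟩, rfl⟩ := ν
  refine ⟨l.get, Subtype.ext ?_⟩
  change (Finset.univ : Finset (Fin _)).val.map l.get = _
  rw [Fin.univ_val_map, List.ofFn_get]
  rfl

theorem count_wordSym {α : Type*} [DecidableEq α] (v : Fin d → α) (i : α) :
    (wordSym v : Multiset α).count i = (Finset.univ.filter fun p => v p = i).card := by
  change (Finset.univ.val.map v).count i = _
  rw [Multiset.count_map]
  simp only [eq_comm]
  rfl

theorem wordSym_update {α : Type*} [DecidableEq α] (v : Fin d → α) (i : Fin d) (a : α) :
    (wordSym (Function.update v i a) : Multiset α) + {v i} = (wordSym v : Multiset α) + {a} := by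
  change (Finset.univ : Finset (Fin d)).val.map (Function.update v i a) + {v i} =
    (Finset.univ : Finset (Fin d)).val.map v + {a}
  have h : ((Finset.univ : Finset (Fin d)).erase i).val.map (Function.update v i a) =
      ((Finset.univ : Finset (Fin d)).erase i).val.map v :=
    Multiset.map_congr rfl fun p (hp : p ∈ (Finset.univ : Finset (Fin d)).erase i) =>
      Function.update_of_ne (Finset.ne_of_mem_erase hp) _ _
  rw [← Finset.insert_erase (Finset.mem_univ i),
    Finset.insert_val_of_notMem (Finset.notMem_erase _ _), Multiset.map_cons, Multiset.map_cons, h,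
    Function.update_self, ← Multiset.singleton_add, ← Multiset.singleton_add]
  abel

theorem symPowMatrix_wordSym {R : Type*} [CommRing R] (φ : Matrix (Fin n) (Fin m) R)
    (μ : Sym (Fin n) d) (f : Fin d → Fin m) :
    symPowMatrix d φ μ (wordSym f) =
      ∑ v : Fin d → Fin n, (∏ j, φ (v j) (f j)) * if wordSym v = μ then 1 else 0 := by
  have h1 : (((wordSym f : Sym _ _) : Multiset (Fin m)).map fun j =>
      ∑ i : Fin n, MvPolynomial.C (φ i j) * MvPolynomial.X i).prod =
      ∏ j, ∑ i : Fin n, MvPolynomial.C (φ i (f j)) * MvPolynomial.X i := by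
    change ((Finset.univ.val.map f).map _).prod = _
    rw [Multiset.map_map]
    rfl
  rw [symPowMatrix, h1, Finset.prod_univ_sum, Fintype.piFinset_univ, MvPolynomial.coeff_sum]
  refine Finset.sum_congr rfl fun v _ => ?_
  have h2 : ∏ j, (MvPolynomial.X (v j) : MvPolynomial (Fin n) R) =
      MvPolynomial.monomial (Multiset.toFinsupp (wordSym v : Multiset (Fin n))) 1 := by
    change _ = MvPolynomial.monomial (Multiset.toFinsupp (Finset.univ.val.map v)) 1
    simp_rw [MvPolynomial.X]
    rw [← MvPolynomial.monomial_sum_one]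
    congr 1
    rw [← Multiset.sum_map_singleton (Finset.univ.val.map v), map_multiset_sum]
    simp [List.sum_ofFn]
  rw [Finset.prod_mul_distrib, ← map_prod, MvPolynomial.coeff_C_mul, h2,
    MvPolynomial.coeff_monomial]
  simp

theorem sum_count_sym (hd : 1 ≤ d) (i : Fin n) :
    ∑ μ : Sym (Fin n) d, (μ : Multiset (Fin n)).count i = (n + d - 1).choose (d - 1) := by
  have hsymm : ∀ j, ∑ μ : Sym (Fin n) d, (μ : Multiset (Fin n)).count j =
      ∑ μ : Sym (Fin n) d, (μ : Multiset (Fin n)).count i := by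
    intro j
    refine Fintype.sum_equiv (Sym.equivCongr (Equiv.swap j i)) _ _ fun μ => ?_
    have := Multiset.count_map_eq_count' (Equiv.swap j i) (μ : Multiset (Fin n))
      (Equiv.swap j i).injective j
    rw [Equiv.swap_apply_left] at this
    exact this.symm
  have htot : ∑ j, ∑ μ : Sym (Fin n) d, (μ : Multiset (Fin n)).count j =
      (n + d - 1).choose d * d := by
    rw [Finset.sum_comm]
    have : ∀ μ : Sym (Fin n) d, ∑ j, (μ : Multiset (Fin n)).count j = d := fun μ => by
      exact (Multiset.sum_count_eq_card (by simp)).trans μ.2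
    simp [this, Sym.card_sym_eq_choose]
  rw [Finset.sum_congr rfl fun j _ => hsymm j] at htot
  have hn : 0 < n := i.pos
  obtain ⟨d, rfl⟩ : ∃ e, d = e + 1 := ⟨d - 1, by omega⟩
  rw [Nat.choose_succ_right_eq] at htot
  simp only [Finset.sum_const, Finset.card_univ, Fintype.card_fin, smul_eq_mul] at htot
  rw [show n + (d + 1) - 1 - d = n by omega, mul_comm] at htot
  exact Nat.eq_of_mul_eq_mul_right hn htot

/-- The matrix of the coefficients of the monomials `rows j` in the monomials given by the words
`v k`. -/
def wordMatrix (rows : Fin N → Sym (Fin n) d) (v : Fin N → Fin d → Fin n) :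
    Matrix (Fin N) (Fin N) ℤ :=
  Matrix.of fun j k => if wordSym (v k) = rows j then 1 else 0

/-- The coefficient function of the determinant of `N` products of `d` vectors, regarded as a
multilinear form in the `N * d` vectors. -/
def symPowForm (rows : Fin N → Sym (Fin n) d) (u : Fin (N * d) → Fin n) : ℤ :=
  (wordMatrix rows fun k i => u (finProdFinEquiv (k, i))).det

theorem sum_det_wordMatrix_update {rows : Fin N → Sym (Fin n) d}
    (hrows : Function.Bijective rows) {a b : Fin n} (hab : a ≠ b) (v : Fin N → Fin d → Fin n) :
    ∑ k, ∑ i, (if v k i = b then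
      (wordMatrix rows (Function.update v k (Function.update (v k) i a))).det else 0) = 0 := by
  let T : Matrix (Fin N) (Fin N) ℤ := Matrix.of fun j l =>
    if (rows l : Multiset (Fin n)) + {a} = (rows j : Multiset (Fin n)) + {b} then
      ((rows l : Multiset (Fin n)).count b : ℤ) else 0
  have htr : T.trace = 0 := by
    refine Finset.sum_eq_zero fun j _ => ?_
    simp [T, hab]
  have h := Matrix.sum_det_updateCol_mul T (wordMatrix rows v)
  rw [htr, zero_mul] at h
  refine Eq.trans (Finset.sum_congr rfl fun k _ => ?_) h
  obtain ⟨l, hl⟩ := hrows.2 (wordSym (v k))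
  have hcol : (fun j => (T * wordMatrix rows v) j k) = ∑ i, if v k i = b then
      (fun j => if wordSym (Function.update (v k) i a) = rows j then (1 : ℤ) else 0) else 0 := by
    ext j
    have hT : (T * wordMatrix rows v) j k = T j l := by
      rw [Matrix.mul_apply, Finset.sum_eq_single l]
      · simp [wordMatrix, hl]
      · intro l' _ hne
        simp [wordMatrix, ← hl, hrows.1.eq_iff, hne.symm]
      · simp
    have hterm : ∀ i, (if v k i = b then
        (fun j => if wordSym (Function.update (v k) i a) = rows j then (1 : ℤ) else 0) else 0) j =
        if v k i = b then (if (wordSym (v k) : Multiset (Fin n)) + {a} =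
          (rows j : Multiset (Fin n)) + {b} then (1 : ℤ) else 0) else 0 := by
      intro i
      by_cases hi : v k i = b
      · have := wordSym_update (v k) i a
        rw [hi] at this
        rw [if_pos hi, if_pos hi, ← this]
        simp only [Sym.coe_inj, add_left_inj]
      · rw [if_neg hi, if_neg hi, Pi.zero_apply]
    rw [hT, Finset.sum_apply, Finset.sum_congr rfl fun i _ => hterm i, ← Finset.sum_filter,
      Finset.sum_const, ← count_wordSym]
    simp [T, hl]
  rw [← Matrix.cramer_apply, hcol, map_sum, Finset.sum_apply]
  refine Finset.sum_congr rfl fun i _ => ?_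
  split_ifs with hi
  · rw [Matrix.cramer_apply]
    congr 1
    ext j k'
    by_cases hk : k' = k
    · subst hk
      simp [wordMatrix]
    · simp [wordMatrix, hk]
  · simp

theorem isDetWeight_symPowForm (hd : 1 ≤ d) {rows : Fin N → Sym (Fin n) d}
    (hrows : Function.Bijective rows) :
    IsDetWeight ((n + d - 1).choose (d - 1)) (symPowForm rows) where
  replaceSum_eq_zero a b hab u := by
    rw [← sum_det_wordMatrix_update hrows hab fun k i => u (finProdFinEquiv (k, i)),
      replaceSum, ← finProdFinEquiv.sum_comp, Fintype.sum_prod_type]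
    refine Finset.sum_congr rfl fun k _ => Finset.sum_congr rfl fun i _ => ?_
    congr 1
    rw [symPowForm]
    congr 2
    ext k' i' : 2
    by_cases hk : k' = k
    · subst hk
      simp [Function.update_apply]
    · simp [hk]
  card_eq u hu i := by
    have hinj : Function.Injective fun k => wordSym fun j => u (finProdFinEquiv (k, j)) := by
      intro k l hkl
      by_contra hne
      refine hu (Matrix.det_zero_of_column_eq hne fun j => ?_)
      simp only at hkl
      simp [wordMatrix, hkl]
    have hcard : Fintype.card (Fin N) = Fintype.card (Sym (Fin n) d) :=
      Fintype.card_of_bijective hrows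
    have hbij := (Fintype.bijective_iff_injective_and_card _).2 ⟨hinj, hcard⟩
    rw [← sum_count_sym hd i, ← hbij.sum_comp, Finset.card_filter, ← finProdFinEquiv.sum_comp,
      Fintype.sum_prod_type]
    refine Finset.sum_congr rfl fun k _ => ?_
    rw [count_wordSym, Finset.card_filter]

theorem det_submatrix_symPowMatrix {R : Type*} [CommRing R] (φ : Matrix (Fin n) (Fin m) R)
    (rows : Fin N → Sym (Fin n) d) (f : Fin N → Fin d → Fin m) :
    ((symPowMatrix d φ).submatrix rows fun k => wordSym (f k)).det =
      ∑ u, (symPowForm rows u : R) *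
        ∏ p, φ (u p) (f (finProdFinEquiv.symm p).1 (finProdFinEquiv.symm p).2) := by
  have h := Matrix.det_sum_smul (fun k (v : Fin d → Fin n) => ∏ i, φ (v i) (f k i))
    fun v j => if wordSym v = rows j then (1 : R) else 0
  have hM : (symPowMatrix d φ).submatrix rows (fun k => wordSym (f k)) =
      Matrix.of fun j k => ∑ v : Fin d → Fin n, (∏ i, φ (v i) (f k i)) *
        if wordSym v = rows j then (1 : R) else 0 := by
    ext j k
    exact symPowMatrix_wordSym φ (rows j) (f k)
  rw [hM, h]
  let E : (Fin (N * d) → Fin n) ≃ (Fin N → Fin d → Fin n) :=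
    (finProdFinEquiv.symm.arrowCongr (Equiv.refl _)).trans (Equiv.curry _ _ _)
  symm
  refine Fintype.sum_equiv E _ _ fun u => ?_
  rw [symPowForm, Int.cast_det, mul_comm, ← finProdFinEquiv.prod_comp, Fintype.prod_prod_type]
  simp only [Equiv.symm_apply_apply]
  congr 2
  ext j k
  simp only [wordMatrix, Matrix.map_apply, Matrix.of_apply, Int.cast_ite, Int.cast_one,
    Int.cast_zero]
  rfl

end SymPow

/-- For a commutative ring `R`, a linear map `φ : R^m → R^n` and `d ≥ 1`,
`I(S^d(φ)) ⊆ I(φ)^s` with `s = (n + d - 1).choose (d - 1)`. Here `I(φ) = I_n(φ)` and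
`I(S^d(φ))` is the ideal of minors of size `(n + d - 1).choose d` of `S^d(φ)`. -/
theorem maximalMinors_symPow_subset {R : Type*} [CommRing R] {m n : ℕ}
    (φ : Matrix (Fin n) (Fin m) R) (d : ℕ) (hd : 1 ≤ d) :
    minorsIdeal ((n + d - 1).choose d) (symPowMatrix d φ) ≤
      minorsIdeal n φ ^ ((n + d - 1).choose (d - 1)) := by
  refine Ideal.span_le.2 ?_
  rintro _ ⟨rows, cols, rfl⟩
  by_cases hinj : Function.Injective rows
  · have hbij : Function.Bijective rows :=
      (Fintype.bijective_iff_injective_and_card _).2 ⟨hinj, by simp [Sym.card_sym_eq_choose]⟩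
    choose f hf using fun k => wordSym_surjective (cols k)
    obtain rfl : (fun k => wordSym (f k)) = cols := funext hf
    rw [det_submatrix_symPowMatrix]
    exact (isDetWeight_symPowForm hd hbij).sum_mul_prod_mem (I := minorsIdeal n φ)
      (φ.submatrix id fun p => f (finProdFinEquiv.symm p).1 (finProdFinEquiv.symm p).2)
      fun g => Ideal.subset_span ⟨id, fun i =>
        f (finProdFinEquiv.symm (g i)).1 (finProdFinEquiv.symm (g i)).2, rfl⟩
  · obtain ⟨k, l, hkl, hne⟩ : ∃ k l, rows k = rows l ∧ k ≠ l := by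
      simpa [Function.Injective] using hinj
    rw [Matrix.det_zero_of_row_eq hne (by ext; simp [hkl])]
    exact zero_mem _
end
end

section
/- Let R be a commutative ring, let φ : R^m → R^n be an R-linear map, and let 1 ≤ d ≤ n. Then I(⋀^d(φ)) ⊆ I(φ)^e, where e = binomial(n-1, d-1). -/
noncomputable section

/-- The matrix (in the standard bases) of the `d`-th exterior power
`⋀^d(φ) : ⋀^d(R^m) → ⋀^d(R^n)` of the linear map `φ : R^m → R^n` given by the `n × m`
matrix `A`: rows and columns are indexed by `d`-element subsets, and the entries are the
corresponding `d × d` minors of `A`. -/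
def extPowMatrix {R : Type*} [CommRing R] {m n : ℕ} (d : ℕ) (A : Matrix (Fin n) (Fin m) R) :
    Matrix {s : Finset (Fin n) // s.card = d} {s : Finset (Fin m) // s.card = d} R :=
  fun S T => (A.submatrix (S.1.orderEmbOfFin S.2) (T.1.orderEmbOfFin T.2)).det

/-- Grouping the arguments of a multilinear map into blocks: apply `h` to each block and `G` to
the resulting family. -/
def MultilinearMap.blockComp {R ι J K M N P : Type*} [CommRing R] [AddCommGroup M] [Module R M]
    [AddCommGroup N] [Module R N] [AddCommGroup P] [Module R P]
    (G : MultilinearMap R (fun _ : J => N) P) (h : MultilinearMap R (fun _ : K => M) N)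
    (c : J × K ≃ ι) : MultilinearMap R (fun _ : ι => M) P := by
  classical
  have key (v : ι → M) (p : ι) (x : M) :
      (fun j => h fun k => Function.update v p x (c (j, k))) =
        Function.update (fun j => h fun k => v (c (j, k))) (c.symm p).1
          (h (Function.update (fun k => v (c ((c.symm p).1, k))) (c.symm p).2 x)) := by
    obtain ⟨⟨j₀, k₀⟩, rfl⟩ := c.surjective p
    funext j
    simp only [Equiv.symm_apply_apply]
    by_cases hj : j = j₀
    · subst hj
      rw [Function.update_self]
      congr 1
      funext k
      by_cases hk : k = k₀ <;> simp [hk]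
    · simp [hj]
  exact MultilinearMap.mk' (fun v => G fun j => h fun k => v (c (j, k)))
    (by intro v p x y; simp only [key, MultilinearMap.map_update_add])
    (by intro v p r x; simp only [key, MultilinearMap.map_update_smul])

@[simp]
theorem MultilinearMap.blockComp_apply {R ι J K M N P : Type*} [CommRing R] [AddCommGroup M]
    [Module R M] [AddCommGroup N] [Module R N] [AddCommGroup P] [Module R P]
    (G : MultilinearMap R (fun _ : J => N) P) (h : MultilinearMap R (fun _ : K => M) N)
    (c : J × K ≃ ι) (v : ι → M) :
    G.blockComp h c v = G fun j => h fun k => v (c (j, k)) := rfl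

/-- A multilinear form on `R^n` is determined by its values on families of standard basis
vectors. -/
theorem MultilinearMap.apply_eq_sum_single {R ι κ : Type*} [CommRing R] [Fintype ι]
    [DecidableEq ι] [Fintype κ] [DecidableEq κ] (f : MultilinearMap R (fun _ : ι => κ → R) R)
    (v : ι → κ → R) :
    f v = ∑ w : ι → κ, f (fun p => Pi.single (w p) 1) * ∏ p, v p (w p) := by
  have hv : v = fun p => ∑ i, v p i • (Pi.single i 1 : κ → R) := by
    funext p
    exact pi_eq_sum_univ' (v p) |>.trans (by
      refine Finset.sum_congr rfl fun i _ => ?_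
      congr 1)
  conv_lhs => rw [hv]
  rw [MultilinearMap.map_sum]
  refine Finset.sum_congr rfl fun w _ => ?_
  rw [MultilinearMap.map_smul_univ, smul_eq_mul, mul_comm]

/-- The up operator on `k`-subsets of a finite set is injective when `2 * k < |T|`. -/
theorem Finset.eq_zero_of_sum_erase_eq_zero {T : Type*} [Fintype T] [DecidableEq T] (k : ℕ)
    (hk : 2 * k < Fintype.card T) (G : Finset T → ℤ)
    (hG : ∀ A : Finset T, A.card = k + 1 → ∑ x ∈ A, G (A.erase x) = 0)
    (B : Finset T) (hB : B.card = k) : G B = 0 := by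
  wlog hsupp : ∀ B : Finset T, B.card ≠ k → G B = 0 generalizing G
  · have := this (fun B => if B.card = k then G B else 0) (fun A hA => by
      rw [← hG A hA]
      refine Finset.sum_congr rfl fun x hx => ?_
      simp [Finset.card_erase_of_mem hx, hA]) (fun B hB => by simp [hB])
    simpa [hB] using this
  let H : Finset T → ℤ := fun C => ∑ x ∈ Cᶜ, G (insert x C)
  have adj : ∑ B : Finset T, (∑ y ∈ B, H (B.erase y)) * G B = ∑ C : Finset T, H C * H C := by
    have gen (K : Finset T → ℤ) : ∑ B : Finset T, (∑ y ∈ B, K (B.erase y)) * G B =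
        ∑ C : Finset T, K C * ∑ x ∈ Cᶜ, G (insert x C) := by
      simp only [Finset.sum_mul, Finset.mul_sum]
      rw [Finset.sum_sigma', Finset.sum_sigma']
      refine Finset.sum_bij'
        (fun (p : (_ : Finset T) × T) _ => (⟨p.1.erase p.2, p.2⟩ : (_ : Finset T) × T))
        (fun (p : (_ : Finset T) × T) _ => (⟨insert p.2 p.1, p.2⟩ : (_ : Finset T) × T))
        ?_ ?_ ?_ ?_ ?_
      · rintro ⟨B, y⟩ h; simp
      · rintro ⟨B, y⟩ h; simp
      · rintro ⟨B, y⟩ h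
        simp only [Finset.mem_sigma, Finset.mem_univ, true_and] at h
        simp [Finset.insert_erase h]
      · rintro ⟨B, y⟩ h
        simp only [Finset.mem_sigma, Finset.mem_univ, true_and, Finset.mem_compl] at h
        simp [Finset.erase_insert h]
      · rintro ⟨B, y⟩ h
        simp only [Finset.mem_sigma, Finset.mem_univ, true_and] at h
        simp [Finset.insert_erase h]
    exact gen H
  have comm (B : Finset T) :
      (∑ y ∈ B, H (B.erase y)) * G B = -(((Fintype.card T : ℤ) - 2 * k) * (G B * G B)) := by
    by_cases hB : B.card = k
    swap
    · simp [hsupp B hB]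
    have h1 : ∑ y ∈ B, H (B.erase y) =
        k * G B + ∑ y ∈ B, ∑ x ∈ Bᶜ, G (insert x (B.erase y)) := by
      have : ∀ y ∈ B, H (B.erase y) = G B + ∑ x ∈ Bᶜ, G (insert x (B.erase y)) := by
        intro y hy
        simp only [H]
        rw [Finset.compl_erase, Finset.sum_insert (by simpa using hy), Finset.insert_erase hy]
      rw [Finset.sum_congr rfl this, Finset.sum_add_distrib]
      simp [hB]
    have h2 : 0 = ((Fintype.card T : ℤ) - k) * G B +
        ∑ x ∈ Bᶜ, ∑ y ∈ B, G (insert x (B.erase y)) := by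
      have : ∀ x ∈ Bᶜ, 0 = G B + ∑ y ∈ B, G (insert x (B.erase y)) := by
        intro x hx
        rw [Finset.mem_compl] at hx
        rw [← hG (insert x B) (by rw [Finset.card_insert_of_notMem hx, hB]),
          Finset.sum_insert hx, Finset.erase_insert hx]
        congr 1
        refine Finset.sum_congr rfl fun y hy => ?_
        rw [Finset.erase_insert_of_ne]
        rintro rfl
        exact hx hy
      have h3 := Finset.sum_congr rfl this
      rw [Finset.sum_add_distrib] at h3
      simpa [Finset.card_compl, hB, Nat.cast_sub (hB ▸ Finset.card_le_univ B : k ≤ _)] using h3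
    rw [Finset.sum_comm] at h2
    rw [h1]
    linear_combination (-G B) * h2
  have total : ∑ B : Finset T, (((Fintype.card T : ℤ) - 2 * k) * (G B * G B)) ≤ 0 := by
    have h0 : (0 : ℤ) ≤ ∑ C : Finset T, H C * H C :=
      Finset.sum_nonneg fun C _ => mul_self_nonneg _
    rw [← adj, Finset.sum_congr rfl fun B _ => comm B, Finset.sum_neg_distrib] at h0
    linarith
  have hpos : (0 : ℤ) < (Fintype.card T : ℤ) - 2 * k := by
    have : ((2 * k : ℕ) : ℤ) < Fintype.card T := by exact_mod_cast hk
    push_cast at this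
    linarith
  have hle := Finset.single_le_sum (f := fun B => ((Fintype.card T : ℤ) - 2 * k) * (G B * G B))
    (fun B _ => mul_nonneg hpos.le (mul_self_nonneg _)) (Finset.mem_univ B)
  have : ((Fintype.card T : ℤ) - 2 * k) * (G B * G B) ≤ 0 := hle.trans total
  have h4 : G B * G B ≤ 0 := nonpos_of_mul_nonpos_right this hpos
  exact mul_self_eq_zero.mp (le_antisymm h4 (mul_self_nonneg _))

/-- The integer-valued functions on words in the alphabet `Fin n` (thought of as multilinear
forms) of weight `(e, …, e)` killed by all root vectors of `gl_n`. -/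
def wordInvariants (ι : Type*) [Fintype ι] [DecidableEq ι] (n e : ℕ) :
    Submodule ℤ ((ι → Fin n) → ℤ) where
  carrier := {F | (∀ w, F w ≠ 0 → ∀ i, (Finset.univ.filter fun p => w p = i).card = e) ∧
    ∀ (w : ι → Fin n) (i i' : Fin n), i ≠ i' →
      ∑ p ∈ Finset.univ.filter (fun p => w p = i'), F (Function.update w p i) = 0}
  zero_mem' := by simp
  add_mem' := by
    rintro F G ⟨hF, hF'⟩ ⟨hG, hG'⟩
    refine ⟨fun w hw => ?_, fun w i i' h => ?_⟩
    · by_cases h : F w = 0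
      · exact hG w fun h' => hw (by simp [h, h'])
      · exact hF w h
    · simp [Finset.sum_add_distrib, hF' w i i' h, hG' w i i' h]
  smul_mem' := by
    rintro a F ⟨hF, hF'⟩
    refine ⟨fun w hw => hF w fun h => hw (by simp [h]), fun w i i' h => ?_⟩
    simp [← Finset.mul_sum, hF' w i i' h]

theorem mem_wordInvariants {ι : Type*} [Fintype ι] [DecidableEq ι] {n e : ℕ}
    {F : (ι → Fin n) → ℤ} : F ∈ wordInvariants ι n e ↔
      (∀ w, F w ≠ 0 → ∀ i, (Finset.univ.filter fun p => w p = i).card = e) ∧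
        ∀ (w : ι → Fin n) (i i' : Fin n), i ≠ i' →
          ∑ p ∈ Finset.univ.filter (fun p => w p = i'), F (Function.update w p i) = 0 := Iff.rfl

/-- The lexicographically first word in the support of an invariant is a lattice word. -/
theorem card_filter_le_of_first {ι : Type*} [Fintype ι] [LinearOrder ι] {n e : ℕ}
    {F : (ι → Fin n) → ℤ} (hF : F ∈ wordInvariants ι n e) {w : ι → Fin n} (hw : F w ≠ 0)
    (hmin : ∀ w' : ι → Fin n, toLex w' < toLex w → F w' = 0) {i i' : Fin n} (hi : i < i') (p : ι) :
    (Finset.univ.filter fun q => q ≤ p ∧ w q = i').card ≤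
      (Finset.univ.filter fun q => q ≤ p ∧ w q = i).card := by
  by_contra! hlt
  obtain ⟨hwt, hroot⟩ := mem_wordInvariants.mp hF
  have split (j : Fin n) : (Finset.univ.filter fun q => q ≤ p ∧ w q = j).card +
      (Finset.univ.filter fun q => p < q ∧ w q = j).card = e := by
    rw [← hwt w hw j, ← Finset.card_union_of_disjoint]
    · congr 1
      ext q
      have := le_or_gt q p
      simp only [Finset.mem_union, Finset.mem_filter, Finset.mem_univ, true_and]
      tauto
    · rw [Finset.disjoint_left]
      intro q hq hq'
      simp only [Finset.mem_filter, Finset.mem_univ, true_and] at hq hq'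
      exact absurd hq.1 (not_le.mpr hq'.1)
  let T := {q : ι // p < q ∧ (w q = i ∨ w q = i')}
  let word (B : Finset T) : ι → Fin n := fun q =>
    if h : p < q ∧ (w q = i ∨ w q = i') then (if (⟨q, h⟩ : T) ∈ B then i' else i) else w q
  have hcard : Fintype.card T = (Finset.univ.filter fun q => p < q ∧ w q = i).card +
      (Finset.univ.filter fun q => p < q ∧ w q = i').card := by
    rw [Fintype.card_subtype, ← Finset.card_union_of_disjoint]
    · congr 1
      ext q
      simp only [Finset.mem_union, Finset.mem_filter, Finset.mem_univ, true_and]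
      tauto
    · rw [Finset.disjoint_left]
      intro q hq hq'
      simp only [Finset.mem_filter, Finset.mem_univ, true_and] at hq hq'
      exact hi.ne (hq.2.symm.trans hq'.2)
  let B₀ : Finset T := Finset.univ.filter fun t => w t = i'
  have hB₀ : B₀.card = (Finset.univ.filter fun q => p < q ∧ w q = i').card := by
    rw [← Finset.card_map (Function.Embedding.subtype _)]
    congr 1
    ext q
    simp only [B₀, T, Finset.mem_map, Finset.mem_filter, Finset.mem_univ, true_and,
      Function.Embedding.subtype_apply, Subtype.exists, exists_and_left, exists_prop,
      exists_eq_right_right]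
    tauto
  have hword : word B₀ = w := by
    funext q
    by_cases h : p < q ∧ (w q = i ∨ w q = i')
    · rcases h.2 with h' | h'
      · simp [word, h, B₀, h', hi.ne]
      · simp [word, h, B₀, h']
    · simp only [word, dif_neg h]
  refine hw ?_
  rw [← hword]
  refine Finset.eq_zero_of_sum_erase_eq_zero B₀.card ?_ (fun B => F (word B)) ?_ B₀ rfl
  · have h1 := split i
    have h2 := split i'
    omega
  intro A _
  rw [← hroot (word A) i i' hi.ne]
  have hsub : A.map (Function.Embedding.subtype _) ⊆
      Finset.univ.filter (fun q => word A q = i') := by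
    intro q hq
    obtain ⟨t, ht, rfl⟩ := Finset.mem_map.mp hq
    simp only [Finset.mem_filter, Finset.mem_univ, true_and, Function.Embedding.subtype_apply]
    simp only [word, dif_pos t.2, Subtype.coe_eta, if_pos ht]
  rw [← Finset.sum_subset hsub, Finset.sum_map]
  · refine Finset.sum_congr rfl fun t _ => ?_
    congr 1
    funext q
    simp only [Function.Embedding.subtype_apply]
    by_cases hq : q = t
    · subst hq
      simp only [word, dif_pos t.2, Function.update_self, Subtype.coe_eta, Finset.notMem_erase,
        if_false]
    · rw [Function.update_of_ne hq]
      by_cases h : p < q ∧ (w q = i ∨ w q = i')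
      · have : (⟨q, h⟩ : T) ≠ t := fun h' => hq (congrArg Subtype.val h')
        simp only [word, dif_pos h, Finset.mem_erase, ne_eq, this, not_false_eq_true, true_and]
      · simp only [word, dif_neg h]
  · intro q hq hq'
    simp only [Finset.mem_filter, Finset.mem_univ, true_and] at hq
    have hT : ¬ (p < q ∧ (w q = i ∨ w q = i')) := by
      intro h
      refine hq' (Finset.mem_map.mpr ⟨⟨q, h⟩, ?_, rfl⟩)
      by_contra hA
      simp only [word, dif_pos h, if_neg hA] at hq
      exact hi.ne hq
    simp only [word, dif_neg hT] at hq
    have hqp : q ≤ p := by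
      by_contra! h
      exact hT ⟨h, Or.inr hq⟩
    apply hmin
    refine ⟨q, fun j hj => ?_, ?_⟩
    · have hj' : ¬ (p < j ∧ (w j = i ∨ w j = i')) := fun h => absurd h.1 (not_lt.mpr (hj.le.trans hqp))
      simp only [Pi.toLex_apply, Function.update_of_ne hj.ne, word, dif_neg hj']
    · simpa [hq] using hi

/-- A lattice word of weight `(e, …, e)` is obtained by a standard filling of the `e × n`
rectangle. -/
theorem exists_standard_filling {ι : Type*} [Fintype ι] [LinearOrder ι] {n e : ℕ}
    {w : ι → Fin n} (hwt : ∀ i, (Finset.univ.filter fun p => w p = i).card = e)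
    (hlat : ∀ i i' : Fin n, i < i' → ∀ p, (Finset.univ.filter fun q => q ≤ p ∧ w q = i').card ≤
      (Finset.univ.filter fun q => q ≤ p ∧ w q = i).card) :
    ∃ c : Fin e × Fin n ≃ ι, (∀ a i, w (c (a, i)) = i) ∧
      ∀ a i i', i < i' → c (a, i) < c (a, i') := by
  let c (a : Fin e) (i : Fin n) : ι := (Finset.univ.filter fun p => w p = i).orderEmbOfFin (hwt i) a
  have hc a i : w (c a i) = i := by
    have := Finset.orderEmbOfFin_mem (Finset.univ.filter fun p => w p = i) (hwt i) a
    exact (Finset.mem_filter.mp this).2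
  have hbij : Function.Bijective fun x : Fin e × Fin n => c x.1 x.2 := by
    constructor
    · rintro ⟨a, i⟩ ⟨b, j⟩ h
      have hij : i = j := by rw [← hc a i, ← hc b j]; exact congrArg w h
      subst hij
      exact Prod.ext (((Finset.univ.filter fun p => w p = i).orderEmbOfFin (hwt i)).injective h) rfl
    · intro p
      have : p ∈ Set.range ((Finset.univ.filter fun q => w q = w p).orderEmbOfFin (hwt (w p))) := by
        rw [Finset.range_orderEmbOfFin]
        simp
      obtain ⟨a, ha⟩ := this
      exact ⟨(a, w p), ha⟩
  refine ⟨Equiv.ofBijective _ hbij, hc, fun a i i' hi => ?_⟩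
  change c a i < c a i'
  by_contra! hle
  have h1 : ((Finset.univ.filter fun b : Fin e => b ≤ a).image fun b => c b i').card ≤
      (Finset.univ.filter fun q => q ≤ c a i' ∧ w q = i').card := by
    refine Finset.card_le_card fun q hq => ?_
    obtain ⟨b, hb, rfl⟩ := Finset.mem_image.mp hq
    simp only [Finset.mem_filter, Finset.mem_univ, true_and] at hb ⊢
    exact ⟨(Finset.orderEmbOfFin _ (hwt i')).monotone hb, hc b i'⟩
  have h2 : (Finset.univ.filter fun q => q ≤ c a i' ∧ w q = i).card ≤
      ((Finset.univ.filter fun b : Fin e => b < a).image fun b => c b i).card := by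
    refine Finset.card_le_card fun q hq => ?_
    simp only [Finset.mem_filter, Finset.mem_univ, true_and] at hq
    obtain ⟨⟨b, j⟩, rfl⟩ := hbij.2 q
    obtain rfl : j = i := (hc b j).symm.trans hq.2
    refine Finset.mem_image.mpr ⟨b, ?_, rfl⟩
    simp only [Finset.mem_filter, Finset.mem_univ, true_and]
    refine (Finset.orderEmbOfFin _ (hwt j)).lt_iff_lt.mp ((hq.1.trans hle).lt_of_ne ?_)
    intro h
    have h' : c a j = c a i' := le_antisymm (h ▸ hq.1) hle
    exact hi.ne ((hc a j).symm.trans ((congrArg w h').trans (hc a i')))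
  rw [Finset.card_image_of_injective _ (Finset.orderEmbOfFin _ (hwt i')).injective] at h1
  have h3 := h1.trans ((hlat i i' hi _).trans (h2.trans Finset.card_image_le))
  have h4 : (Finset.univ.filter fun b : Fin e => b < a) ⊂ Finset.univ.filter fun b => b ≤ a := by
    refine Finset.ssubset_iff_subset_ne.mpr ⟨fun b hb => ?_, fun h => ?_⟩
    · simp only [Finset.mem_filter, Finset.mem_univ, true_and] at hb ⊢
      exact hb.le
    · have : a ∈ Finset.univ.filter fun b : Fin e => b < a := h ▸ by simp
      simp at this
  exact absurd (Finset.card_lt_card h4) (not_lt.mpr h3)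

/-- A relatively `GL_n`-invariant multilinear form of weight `(e, …, e)` gives an invariant
function on words. -/
theorem mem_wordInvariants_of_map {ι : Type*} [Fintype ι] [DecidableEq ι] {n e : ℕ}
    (f : MultilinearMap ℤ (fun _ : ι => Fin n → ℤ) ℤ)
    (hwt : ∀ w : ι → Fin n, f (fun p => Pi.single (w p) 1) ≠ 0 →
      ∀ i, (Finset.univ.filter fun p => w p = i).card = e)
    (hinv : ∀ g : (Fin n → ℤ) →ₗ[ℤ] (Fin n → ℤ), ∃ c : ℤ, ∀ v, f (fun p => g (v p)) = c * f v) :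
    (fun w => f fun p => Pi.single (w p) 1) ∈ wordInvariants ι n e := by
  refine mem_wordInvariants.mpr ⟨hwt, fun w i i' hi => ?_⟩
  by_cases hcount : (Finset.univ.filter fun p => w p = i').card = e + 1
  swap
  · refine Finset.sum_eq_zero fun p hp => ?_
    by_contra hne
    have h := hwt _ hne i'
    rw [Finset.mem_filter] at hp
    refine hcount ?_
    rw [← h, ← Finset.card_erase_add_one (a := p) (s := Finset.univ.filter fun p => w p = i')
      (by simpa using hp.2)]
    congr 2
    ext q
    by_cases hq : q = p <;> simp [hq, hi]
  let g : (Fin n → ℤ) →ₗ[ℤ] (Fin n → ℤ) :=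
    LinearMap.id + (LinearMap.single ℤ (fun _ => ℤ) i).comp (LinearMap.proj i')
  obtain ⟨c, hc⟩ := hinv g
  have hw : f (fun p => Pi.single (w p) 1) = 0 := by
    by_contra h
    have := hwt w h i'
    omega
  let m : ι → Fin n → ℤ := fun p => Pi.single (w p) 1
  let m' : ι → Fin n → ℤ := fun p => if w p = i' then Pi.single i 1 else 0
  have hg : (fun p => g (m p)) = m' + m := by
    funext p
    by_cases h : w p = i'
    · simp [g, m, m', h, add_comm]
    · simp [g, m, m', h]
  have hsum := hc m
  rw [hg, hw, mul_zero, MultilinearMap.map_add_univ] at hsum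
  have hpw (s : Finset ι) (hs : ∀ p ∈ s, w p = i') :
      s.piecewise m' m = fun p => Pi.single (if p ∈ s then i else w p) 1 := by
    funext p
    by_cases hp : p ∈ s
    · simp [hp, m', hs p hp]
    · simp [hp, m]
  rw [← hsum]
  have hsub : ((Finset.univ.filter fun p => w p = i').map
      ⟨fun p => ({p} : Finset ι), Finset.singleton_injective⟩) ⊆ Finset.univ :=
    Finset.subset_univ _
  rw [← Finset.sum_subset hsub, Finset.sum_map]
  · refine Finset.sum_congr rfl fun p hp => ?_
    rw [Finset.mem_filter] at hp
    simp only [Function.Embedding.coeFn_mk]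
    rw [hpw {p} (by simpa using hp.2)]
    congr 1
    funext q
    by_cases hq : q = p <;> simp [hq]
  · intro s _ hs
    by_cases hs' : ∀ p ∈ s, w p = i'
    · rw [hpw s hs']
      by_contra hne
      have h := hwt _ hne i'
      have hsd : (Finset.univ.filter fun p => (if p ∈ s then i else w p) = i') =
          (Finset.univ.filter fun p => w p = i') \ s := by
        ext p
        by_cases hp : p ∈ s <;> simp [hp, hi]
      have hss : s ⊆ Finset.univ.filter fun p => w p = i' := fun p hp => by simpa using hs' p hp
      rw [hsd, Finset.card_sdiff_of_subset hss, hcount] at h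
      have := Finset.card_le_card hss
      have h1 : s.card = 1 := by omega
      obtain ⟨p, rfl⟩ := Finset.card_eq_one.mp h1
      exact hs (Finset.mem_map.mpr ⟨p, hss (Finset.mem_singleton_self p), rfl⟩)
    · push Not at hs'
      obtain ⟨p, hp, hne⟩ := hs'
      exact f.map_coord_zero p (by simp [hp, m', hne])

theorem exists_perm_of_det_single_ne_zero {R κ K : Type*} [CommRing R] [Fintype K]
    [DecidableEq K] [DecidableEq κ] (u s : K → κ)
    (h : (Matrix.of fun a b => (Pi.single (u a) 1 : κ → R) (s b)).det ≠ 0) :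
    ∃ τ : Equiv.Perm K, ∀ a, u (τ a) = s a := by
  rw [Matrix.det_apply] at h
  obtain ⟨τ, -, hτ⟩ := Finset.exists_ne_zero_of_sum_ne_zero h
  refine ⟨τ, fun a => ?_⟩
  by_contra hne
  refine hτ ?_
  rw [Finset.prod_eq_zero (Finset.mem_univ a), smul_zero]
  exact Pi.single_eq_of_ne (Ne.symm hne) _

/-- The product of the maximal minors on the blocks `c (a, ·)`. -/
def bracketForm (R : Type*) [CommRing R] {ι : Type*} {n e : ℕ} (c : Fin e × Fin n ≃ ι) :
    MultilinearMap R (fun _ : ι => Fin n → R) R :=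
  (MultilinearMap.mkPiAlgebra R (Fin e) R).blockComp
    (Matrix.detRowAlternating (n := Fin n) (R := R)).toMultilinearMap c

theorem bracketForm_apply {R : Type*} [CommRing R] {ι : Type*} {n e : ℕ} (c : Fin e × Fin n ≃ ι)
    (v : ι → Fin n → R) :
    bracketForm R c v = ∏ a, (Matrix.of fun k => v (c (a, k))).det := by
  simp only [bracketForm, MultilinearMap.blockComp_apply, MultilinearMap.mkPiAlgebra_apply]
  rfl

theorem exists_perm_of_bracketForm_ne_zero {R ι : Type*} [CommRing R] {n e : ℕ}
    (c : Fin e × Fin n ≃ ι) (w : ι → Fin n) (h : bracketForm R c (fun p => Pi.single (w p) 1) ≠ 0)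
    (a : Fin e) : ∃ τ : Equiv.Perm (Fin n), ∀ i, w (c (a, τ i)) = i := by
  rw [bracketForm_apply] at h
  refine exists_perm_of_det_single_ne_zero (R := R) (fun k => w (c (a, k))) id fun h0 => h ?_
  exact Finset.prod_eq_zero (Finset.mem_univ a) h0

theorem card_filter_eq_of_bracketForm_ne_zero {R ι : Type*} [CommRing R] [Fintype ι] {n e : ℕ}
    (c : Fin e × Fin n ≃ ι) (w : ι → Fin n) (h : bracketForm R c (fun p => Pi.single (w p) 1) ≠ 0)
    (i : Fin n) : (Finset.univ.filter fun p => w p = i).card = e := by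
  choose τ hτ using exists_perm_of_bracketForm_ne_zero c w h
  have hinj : Function.Injective fun a => c (a, τ a i) := fun a b hab =>
    congrArg Prod.fst (c.injective hab)
  rw [← Finset.card_fin e, ← Finset.card_map ⟨_, hinj⟩]
  congr 1
  ext p
  obtain ⟨⟨a, k⟩, rfl⟩ := c.surjective p
  obtain ⟨j, rfl⟩ := (τ a).surjective k
  simp only [Finset.mem_filter, Finset.mem_univ, true_and, hτ, Finset.mem_map,
    Function.Embedding.coeFn_mk, EmbeddingLike.apply_eq_iff_eq, Prod.mk.injEq]
  constructor
  · rintro rfl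
    exact ⟨a, rfl, rfl⟩
  · rintro ⟨b, rfl, hb⟩
    exact ((τ b).injective hb).symm

theorem bracketForm_mem_wordInvariants {ι : Type*} [Fintype ι] [DecidableEq ι] {n e : ℕ}
    (c : Fin e × Fin n ≃ ι) :
    (fun w => bracketForm ℤ c fun p => Pi.single (w p) 1) ∈ wordInvariants ι n e := by
  refine mem_wordInvariants_of_map _ (card_filter_eq_of_bracketForm_ne_zero c) fun g =>
    ⟨LinearMap.det g ^ e, fun v => ?_⟩
  have h (a : Fin e) : (Matrix.of fun k => g (v (c (a, k)))).det =
      LinearMap.det g * (Matrix.of fun k => v (c (a, k))).det := by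
    have := (Pi.basisFun ℤ (Fin n)).det_comp g fun k => v (c (a, k))
    simp only [Pi.basisFun_det] at this
    exact this
  simp only [bracketForm_apply, h, Finset.prod_mul_distrib, Finset.prod_const, Finset.card_univ,
    Fintype.card_fin]

theorem bracketForm_standard {R ι : Type*} [CommRing R] {n e : ℕ} (c : Fin e × Fin n ≃ ι)
    (w : ι → Fin n) (h : ∀ a i, w (c (a, i)) = i) :
    bracketForm R c (fun p => Pi.single (w p) 1) = 1 := by
  rw [bracketForm_apply]
  refine Finset.prod_eq_one fun a _ => ?_
  rw [← Matrix.det_one (n := Fin n)]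
  congr 1
  ext k i
  simp [h, Matrix.one_apply, Pi.single_apply, eq_comm]

theorem bracketForm_eq_zero_of_lt {R ι : Type*} [CommRing R] [LinearOrder ι] {n e : ℕ}
    (c : Fin e × Fin n ≃ ι) (w w' : ι → Fin n) (h : ∀ a i, w (c (a, i)) = i)
    (hc : ∀ a i i', i < i' → c (a, i) < c (a, i')) (hlt : toLex w' < toLex w) :
    bracketForm R c (fun p => Pi.single (w' p) 1) = 0 := by
  by_contra hne
  obtain ⟨p, hp, hlt'⟩ := hlt
  simp only [Pi.toLex_apply] at hp hlt'
  obtain ⟨⟨a, k⟩, rfl⟩ := c.surjective p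
  obtain ⟨τ, hτ⟩ := exists_perm_of_bracketForm_ne_zero c w' hne a
  rw [h] at hlt'
  set i := w' (c (a, k)) with hi
  have h1 : w' (c (a, i)) = i := by rw [hp _ (hc a i k hlt'), h]
  have inj : Function.Injective fun k => w' (c (a, k)) := by
    have : Function.LeftInverse (fun k => w' (c (a, k))) τ := hτ
    intro x y hxy
    obtain ⟨x, rfl⟩ := τ.surjective x
    obtain ⟨y, rfl⟩ := τ.surjective y
    simp only [hτ] at hxy
    rw [hxy]
  exact hlt'.ne (inj (h1.trans hi))

/-- The first fundamental theorem for multilinear `SL_n`-invariants over `ℤ`. -/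
theorem wordInvariants_le_span {ι : Type*} [Fintype ι] [LinearOrder ι] {n e : ℕ} :
    wordInvariants ι n e ≤ Submodule.span ℤ (Set.range fun c : Fin e × Fin n ≃ ι =>
      fun w => bracketForm ℤ c fun p => Pi.single (w p) 1) := by
  have key (x : Lex (ι → Fin n)) : ∀ F ∈ wordInvariants ι n e, F (ofLex x) ≠ 0 →
      (∀ w' : ι → Fin n, toLex w' < x → F w' = 0) →
      F ∈ Submodule.span ℤ (Set.range fun c : Fin e × Fin n ≃ ι =>
        fun w => bracketForm ℤ c fun p => Pi.single (w p) 1) := by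
    induction x using WellFoundedGT.induction with
    | ind x ih =>
      intro F hF hne hmin
      obtain ⟨c, hc, hc'⟩ := exists_standard_filling ((mem_wordInvariants.mp hF).1 _ hne)
        fun i i' hi p => card_filter_le_of_first hF hne hmin hi p
      set B : (ι → Fin n) → ℤ := fun w => bracketForm ℤ c fun p => Pi.single (w p) 1 with hB
      have hBs : B ∈ Submodule.span ℤ (Set.range fun c : Fin e × Fin n ≃ ι =>
          fun w => bracketForm ℤ c fun p => Pi.single (w p) 1) :=
        Submodule.subset_span ⟨c, rfl⟩
      have hB1 : B (ofLex x) = 1 := bracketForm_standard c _ hc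
      let F' := F - F (ofLex x) • B
      have hF' : F' ∈ wordInvariants ι n e :=
        sub_mem hF (Submodule.smul_mem _ _ (bracketForm_mem_wordInvariants c))
      have hle (w' : ι → Fin n) (h : toLex w' ≤ x) : F' w' = 0 := by
        rcases h.lt_or_eq with h | rfl
        · simp only [F', Pi.sub_apply, Pi.smul_apply, hmin w' h]
          simp [hB, bracketForm_eq_zero_of_lt c _ w' hc hc' h]
        · have hB1' : B w' = 1 := hB1
          simp [F', hB1']
      have hFF' : F = F' + F (ofLex x) • B := by simp [F']
      rw [hFF']
      refine add_mem ?_ (Submodule.smul_mem _ _ hBs)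
      by_cases hz : ∃ y : Lex (ι → Fin n), F' (ofLex y) ≠ 0
      · obtain ⟨y, hy, hymin⟩ := WellFounded.has_min (wellFounded_lt (α := Lex (ι → Fin n)))
          {y | F' (ofLex y) ≠ 0} hz
        refine ih y ?_ F' hF' hy fun w' hw' => ?_
        · by_contra hxy
          exact hy (hle (ofLex y) (not_lt.mp hxy))
        · by_contra h
          exact hymin (toLex w') h hw'
      · push Not at hz
        have : F' = 0 := funext fun w => hz (toLex w)
        rw [this]
        exact zero_mem _
  intro F hF
  by_cases hz : ∃ y : Lex (ι → Fin n), F (ofLex y) ≠ 0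
  · obtain ⟨y, hy, hymin⟩ := WellFounded.has_min (wellFounded_lt (α := Lex (ι → Fin n)))
      {y | F (ofLex y) ≠ 0} hz
    refine key y F hF hy fun w' hw' => ?_
    by_contra h
    exact hymin (toLex w') h hw'
  · push Not at hz
    have : F = 0 := funext fun w => hz (toLex w)
    rw [this]
    exact zero_mem _

/-- The determinant of a family of decomposable vectors in the exterior power, as a multilinear
form. -/
def exteriorPowerForm (R : Type*) [CommRing R] {ι : Type*} {n d : ℕ}
    (c : Set.powersetCard (Fin n) d × Fin d ≃ ι) :
    MultilinearMap R (fun _ : ι => Fin n → R) R :=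
  ((Pi.basisFun R (Fin n)).exteriorPower d).det.toMultilinearMap.blockComp
    (exteriorPower.ιMulti R d (M := Fin n → R)).toMultilinearMap c

theorem exteriorPowerForm_apply {R : Type*} [CommRing R] {ι : Type*} {n d : ℕ}
    (c : Set.powersetCard (Fin n) d × Fin d ≃ ι) (v : ι → Fin n → R) :
    exteriorPowerForm R c v = (Matrix.of fun S T : Set.powersetCard (Fin n) d =>
      (Matrix.of fun a b => v (c (T, a)) (S.1.orderEmbOfFin (Set.powersetCard.mem_iff.mp S.2) b)).det).det := by
  simp only [exteriorPowerForm, MultilinearMap.blockComp_apply,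
    AlternatingMap.coe_multilinearMap, Module.Basis.det_apply]
  congr 1
  ext S T
  rw [Module.Basis.toMatrix_apply, exteriorPower.basis_repr_apply,
    exteriorPower.ιMultiDual_apply_ιMulti]
  rfl

theorem card_filter_mem_powersetCard {n d : ℕ} (hd : 1 ≤ d) (i : Fin n) :
    (Finset.univ.filter fun S : Set.powersetCard (Fin n) d => i ∈ S.1).card =
      (n - 1).choose (d - 1) := by
  rw [← Finset.card_map (Function.Embedding.subtype _)]
  have h : (Finset.univ.filter fun S : Set.powersetCard (Fin n) d => i ∈ S.1).map
      (Function.Embedding.subtype _) =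
      ((Finset.univ.erase i).powersetCard (d - 1)).image (insert i) := by
    ext S
    simp only [Finset.mem_map, Finset.mem_filter, Finset.mem_univ, true_and,
      Function.Embedding.subtype_apply, Subtype.exists, exists_and_left, exists_prop,
      exists_eq_right_right, Finset.mem_image, Finset.mem_powersetCard]
    constructor
    · rintro ⟨hi, hS⟩
      have hS' : S.card = d := hS
      exact ⟨S.erase i, ⟨Finset.erase_subset_erase _ (Finset.subset_univ _),
        by rw [Finset.card_erase_of_mem hi, hS']⟩, Finset.insert_erase hi⟩
    · rintro ⟨U, ⟨hU, hcard⟩, rfl⟩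
      have hi : i ∉ U := fun h => by simpa using hU h
      refine ⟨Finset.mem_insert_self _ _, ?_⟩
      change (insert i U).card = d
      rw [Finset.card_insert_of_notMem hi, hcard]
      omega
  rw [h, Finset.card_image_of_injOn, Finset.card_powersetCard, Finset.card_erase_of_mem
    (Finset.mem_univ _), Finset.card_univ, Fintype.card_fin]
  intro U hU V hV hUV
  rw [Finset.mem_coe, Finset.mem_powersetCard] at hU hV
  have hi : i ∉ U := fun h => by simpa using hU.1 h
  have hi' : i ∉ V := fun h => by simpa using hV.1 h
  rw [← Finset.erase_insert hi, ← Finset.erase_insert hi']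
  exact congrArg (Finset.erase · i) hUV

theorem card_filter_eq_of_exteriorPowerForm_ne_zero {R : Type*} [CommRing R] {ι : Type*}
    [Fintype ι] {n d : ℕ} (hd : 1 ≤ d) (c : Set.powersetCard (Fin n) d × Fin d ≃ ι)
    (w : ι → Fin n) (h : exteriorPowerForm R c (fun p => Pi.single (w p) 1) ≠ 0) (i : Fin n) :
    (Finset.univ.filter fun p => w p = i).card = (n - 1).choose (d - 1) := by
  rw [exteriorPowerForm_apply, Matrix.det_apply] at h
  obtain ⟨σ, -, hσ⟩ := Finset.exists_ne_zero_of_sum_ne_zero h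
  have hblock (T : Set.powersetCard (Fin n) d) : ∃ τ : Equiv.Perm (Fin d), ∀ b,
      w (c (T, τ b)) = (σ T).1.orderEmbOfFin (Set.powersetCard.mem_iff.mp (σ T).2) b := by
    refine exists_perm_of_det_single_ne_zero (R := R) (fun a => w (c (T, a))) _ fun h0 => hσ ?_
    rw [Finset.prod_eq_zero (Finset.mem_univ T), smul_zero]
    exact h0
  choose τ hτ using hblock
  have hinj (T : Set.powersetCard (Fin n) d) : Function.Injective fun a => w (c (T, a)) := by
    intro x y hxy
    obtain ⟨x, rfl⟩ := (τ T).surjective x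
    obtain ⟨y, rfl⟩ := (τ T).surjective y
    simp only [hτ] at hxy
    rw [((σ T).1.orderEmbOfFin (Set.powersetCard.mem_iff.mp (σ T).2)).injective hxy]
  rw [← card_filter_mem_powersetCard hd i]
  refine Finset.card_bij (fun p _ => σ (c.symm p).1) ?_ ?_ ?_
  · intro p hp
    obtain ⟨⟨T, a⟩, rfl⟩ := c.surjective p
    obtain ⟨b, rfl⟩ := (τ T).surjective a
    simp only [Finset.mem_filter, Finset.mem_univ, true_and, hτ] at hp
    simp only [Equiv.symm_apply_apply, Finset.mem_filter, Finset.mem_univ, true_and]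
    rw [← hp]
    exact Finset.orderEmbOfFin_mem _ _ _
  · intro p hp q hq hpq
    obtain ⟨⟨T, a⟩, rfl⟩ := c.surjective p
    obtain ⟨⟨U, b⟩, rfl⟩ := c.surjective q
    simp only [Equiv.symm_apply_apply, EmbeddingLike.apply_eq_iff_eq] at hpq
    subst hpq
    simp only [Finset.mem_filter, Finset.mem_univ, true_and] at hp hq
    rw [hinj T (hp.trans hq.symm)]
  · intro S hS
    simp only [Finset.mem_filter, Finset.mem_univ, true_and] at hS
    obtain ⟨T, rfl⟩ := σ.surjective S
    have : i ∈ Set.range ((σ T).1.orderEmbOfFin (Set.powersetCard.mem_iff.mp (σ T).2)) := by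
      rw [Finset.range_orderEmbOfFin]
      exact hS
    obtain ⟨b, hb⟩ := this
    exact ⟨c (T, τ T b), by simp [hτ, hb], by simp⟩

theorem exteriorPowerForm_mem_wordInvariants {ι : Type*} [Fintype ι] [DecidableEq ι] {n d : ℕ}
    (hd : 1 ≤ d) (c : Set.powersetCard (Fin n) d × Fin d ≃ ι) :
    (fun w => exteriorPowerForm ℤ c fun p => Pi.single (w p) 1) ∈
      wordInvariants ι n ((n - 1).choose (d - 1)) := by
  refine mem_wordInvariants_of_map _ (card_filter_eq_of_exteriorPowerForm_ne_zero hd c) fun g =>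
    ⟨LinearMap.det (exteriorPower.map d g), fun v => ?_⟩
  rw [exteriorPowerForm, MultilinearMap.blockComp_apply, MultilinearMap.blockComp_apply]
  simp only [AlternatingMap.coe_multilinearMap]
  rw [← Module.Basis.det_comp]
  congr 1
  funext T
  exact (exteriorPower.map_apply_ιMulti g _).symm

theorem exteriorPowerForm_single_eq_intCast {R : Type*} [CommRing R] {ι : Type*} {n d : ℕ}
    (c : Set.powersetCard (Fin n) d × Fin d ≃ ι) (w : ι → Fin n) :
    exteriorPowerForm R c (fun p => Pi.single (w p) 1) =
      ((exteriorPowerForm ℤ c fun p => Pi.single (w p) 1 : ℤ) : R) := by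
  simp only [exteriorPowerForm_apply]
  change _ = Int.castRingHom R _
  rw [RingHom.map_det]
  congr 1
  ext S T
  simp only [RingHom.mapMatrix_apply, Matrix.map_apply, Matrix.of_apply]
  rw [RingHom.map_det]
  congr 1
  ext a b
  simp [Pi.single_apply]

theorem bracketForm_single_eq_intCast {R : Type*} [CommRing R] {ι : Type*} {n e : ℕ}
    (c : Fin e × Fin n ≃ ι) (w : ι → Fin n) :
    bracketForm R c (fun p => Pi.single (w p) 1) =
      ((bracketForm ℤ c fun p => Pi.single (w p) 1 : ℤ) : R) := by
  simp only [bracketForm_apply]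
  change _ = Int.castRingHom R _
  rw [map_prod]
  refine Finset.prod_congr rfl fun a _ => ?_
  rw [RingHom.map_det]
  congr 1
  ext k i
  simp [Pi.single_apply]

theorem exteriorPowerForm_mem_pow {R : Type*} [CommRing R] {ι : Type*} [Fintype ι]
    [LinearOrder ι] {n d : ℕ} (hd : 1 ≤ d) (c : Set.powersetCard (Fin n) d × Fin d ≃ ι)
    (I : Ideal R) (v : ι → Fin n → R)
    (hI : ∀ q : Fin n → ι, (Matrix.of fun k => v (q k)).det ∈ I) :
    exteriorPowerForm R c v ∈ I ^ (n - 1).choose (d - 1) := by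
  let Ψ : ((ι → Fin n) → ℤ) →ₗ[ℤ] R :=
    ∑ w : ι → Fin n, ((LinearMap.toSpanSingleton ℤ R (∏ p, v p (w p))).comp (LinearMap.proj w))
  have hΨ (F : (ι → Fin n) → ℤ) : Ψ F = ∑ w, (F w : R) * ∏ p, v p (w p) := by
    simp [Ψ]
  have hbr (c : Fin ((n - 1).choose (d - 1)) × Fin n ≃ ι) :
      Ψ (fun w => bracketForm ℤ c fun p => Pi.single (w p) 1) = bracketForm R c v := by
    rw [hΨ, MultilinearMap.apply_eq_sum_single]
    simp only [bracketForm_single_eq_intCast (R := R)]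
  have hle : Submodule.span ℤ (Set.range fun c : Fin ((n - 1).choose (d - 1)) × Fin n ≃ ι =>
      fun w => bracketForm ℤ c fun p => Pi.single (w p) 1) ≤
      ((I ^ (n - 1).choose (d - 1)).restrictScalars ℤ).comap Ψ := by
    rw [Submodule.span_le]
    rintro _ ⟨c, rfl⟩
    change Ψ _ ∈ I ^ _
    rw [hbr, bracketForm_apply]
    have := Ideal.prod_mem_prod (s := Finset.univ) (I := fun _ => I)
      (x := fun a => (Matrix.of fun k => v (c (a, k))).det) fun a _ => hI fun k => c (a, k)
    simpa using this
  have := hle (wordInvariants_le_span (exteriorPowerForm_mem_wordInvariants hd c))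
  change Ψ _ ∈ I ^ _ at this
  rw [hΨ] at this
  rw [MultilinearMap.apply_eq_sum_single]
  simpa only [exteriorPowerForm_single_eq_intCast (R := R)] using this

/-- For a commutative ring `R`, a linear map `φ : R^m → R^n` and `1 ≤ d ≤ n`,
`I(⋀^d(φ)) ⊆ I(φ)^e` with `e = (n - 1).choose (d - 1)`. Here `I(φ) = I_n(φ)` and
`I(⋀^d(φ))` is the ideal of minors of size `n.choose d` of `⋀^d(φ)`. -/
theorem maximalMinors_extPow_subset {R : Type*} [CommRing R] {m n : ℕ}
    (φ : Matrix (Fin n) (Fin m) R) (d : ℕ) (hd : 1 ≤ d) (hdn : d ≤ n) :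
    minorsIdeal (n.choose d) (extPowMatrix d φ) ≤
      minorsIdeal n φ ^ ((n - 1).choose (d - 1)) := by
  refine Ideal.span_le.mpr ?_
  rintro _ ⟨r, c, rfl⟩
  change _ ∈ minorsIdeal n φ ^ ((n - 1).choose (d - 1))
  by_cases hr : Function.Injective r
  swap
  · obtain ⟨x, y, hxy, hne⟩ := Function.not_injective_iff.mp hr
    rw [Matrix.det_zero_of_row_eq hne (by funext j; simp [hxy])]
    exact zero_mem _
  have hcard : Fintype.card (Fin (n.choose d)) =
      Fintype.card {s : Finset (Fin n) // s.card = d} := by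
    simp [Fintype.card_subtype]
  let ρ : Fin (n.choose d) ≃ Set.powersetCard (Fin n) d :=
    Equiv.ofBijective r ((Fintype.bijective_iff_injective_and_card r).mpr ⟨hr, hcard⟩)
  let γ := Fintype.equivFin (Set.powersetCard (Fin n) d × Fin d)
  let col (x : Set.powersetCard (Fin n) d × Fin d) : Fin m :=
    (c (ρ.symm x.1)).1.orderEmbOfFin (c (ρ.symm x.1)).2 x.2
  have key := exteriorPowerForm_mem_pow hd γ (minorsIdeal n φ) (fun p i => φ i (col (γ.symm p)))
    fun q => Ideal.subset_span ⟨id, fun k => col (γ.symm (q k)), by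
      rw [← Matrix.det_transpose]; rfl⟩
  rw [exteriorPowerForm_apply, ← Matrix.det_submatrix_equiv_self ρ] at key
  convert key using 2
  ext x y
  simp only [Matrix.submatrix_apply, Matrix.of_apply, extPowMatrix]
  rw [← Matrix.det_transpose]
  congr 1
  ext a b
  simp only [Matrix.transpose_apply, Matrix.submatrix_apply, Matrix.of_apply, col,
    Equiv.symm_apply_apply]
  rfl
end
end

section
/- Let R be a commutative ring and let φ : R^m → R^n and ψ : R^p → R^q be R-linear maps. Then I(φ ⊗ ψ) ⊆ I(φ)^q · I(ψ)^n, where φ ⊗ ψ : R^m ⊗ R^p → R^n ⊗ R^q is the tensor product of the two maps. -/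
noncomputable section

section MinorsKronecker

open Matrix Finset

theorem Matrix.sum_det_updateCol_mul_s5 {R K : Type*} [CommRing R] [Fintype K] [DecidableEq K]
    (X A : Matrix K K R) :
    ∑ k, (A.updateCol k fun l => (X * A) l k).det = X.trace * A.det := by
  have h : ∀ k, (A.updateCol k fun l => (X * A) l k).det = (A.adjugate * (X * A)) k k := by
    intro k
    rw [← cramer_apply, cramer_eq_adjugate_mulVec]
    rfl
  rw [Finset.sum_congr rfl fun k _ => h k]
  change trace (A.adjugate * (X * A)) = _
  rw [trace_mul_comm, Matrix.mul_assoc, mul_adjugate, Matrix.mul_smul, Matrix.mul_one, trace_smul,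
    smul_eq_mul, mul_comm]

theorem Matrix.det_of_sum {R K J : Type*} [CommRing R] [Fintype K] [DecidableEq K] [Fintype J]
    [DecidableEq J] (P : K → K → J → R) :
    (of fun l k => ∑ j, P l k j).det = ∑ β : K → J, (of fun l k => P l k (β k)).det := by
  have := (detRowAlternating (R := R) (n := K)).toMultilinearMap.map_sum
    (fun k (j : J) l => P l k j)
  rw [← det_transpose]
  simp only [← det_transpose (of fun l k => P l k _)]
  convert this using 2
  · change det _ = det _
    congr 1
    ext k l
    simp
  · rfl

/-- Sums over the upper shadow determine a function above the middle layer of a Boolean lattice. -/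
theorem Finset.eq_zero_of_sum_insert_eq_zero {κ A : Type*} [DecidableEq κ] [AddCommGroup A]
    [IsAddTorsionFree A] (K : Finset κ) (G : Finset κ → A)
    (h : ∀ Y ⊆ K, ∑ k ∈ K \ Y, G (insert k Y) = 0) {X : Finset κ} (hXK : X ⊆ K)
    (hX : #K < 2 * #X) : G X = 0 := by
  let S : ℕ → A := fun j => ∑ Z ∈ K.powerset with #Z = #X ∧ #(Z ∩ X) = j, G Z
  have hrec : ∀ j < #X, (#X - j) • S j + (j + 1) • S (j + 1) = 0 := by
    intro j hj
    have h0 : ∑ Y ∈ K.powerset with #Y + 1 = #X ∧ #(Y ∩ X) = j,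
        ∑ k ∈ K \ Y, G (insert k Y) = 0 :=
      Finset.sum_eq_zero fun Y hY => h Y (by simp at hY; exact hY.1)
    have h1 : ∑ Y ∈ K.powerset with #Y + 1 = #X ∧ #(Y ∩ X) = j,
        ∑ k ∈ K \ Y, G (insert k Y) =
        ∑ Z ∈ K.powerset with #Z = #X, ∑ k ∈ Z with #(Z.erase k ∩ X) = j, G Z := by
      rw [Finset.sum_sigma', Finset.sum_sigma']
      refine Finset.sum_nbij' (fun p => ⟨insert p.2 p.1, p.2⟩) (fun p => ⟨p.1.erase p.2, p.2⟩)
        ?_ ?_ ?_ ?_ ?_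
      · rintro ⟨Y, k⟩ hp
        simp only [mem_sigma, mem_filter, mem_powerset, mem_sdiff] at hp ⊢
        obtain ⟨⟨hY, hc, hj⟩, hk, hkY⟩ := hp
        refine ⟨⟨insert_subset hk hY, by rw [card_insert_of_notMem hkY, hc]⟩,
          mem_insert_self _ _, by rw [erase_insert hkY, hj]⟩
      · rintro ⟨Z, k⟩ hp
        simp only [mem_sigma, mem_filter, mem_powerset, mem_sdiff] at hp ⊢
        obtain ⟨⟨hZ, hc⟩, hk, hj⟩ := hp
        exact ⟨⟨(erase_subset _ _).trans hZ, by rw [card_erase_add_one hk, hc], hj⟩, hZ hk,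
          notMem_erase _ _⟩
      · rintro ⟨Y, k⟩ hp
        simp only [mem_sigma, mem_sdiff] at hp
        simp [erase_insert hp.2.2]
      · rintro ⟨Z, k⟩ hp
        simp only [mem_sigma, mem_filter] at hp
        simp [insert_erase hp.2.1]
      · rintro ⟨Y, k⟩ _
        rfl
    have h2 : ∀ Z ∈ K.powerset.filter (fun Z => #Z = #X),
        ∑ k ∈ Z with #(Z.erase k ∩ X) = j, G Z =
        (if #(Z ∩ X) = j then (#X - j) • G Z else 0) +
          (if #(Z ∩ X) = j + 1 then (j + 1) • G Z else 0) := by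
      intro Z hZ
      simp only [mem_filter, mem_powerset] at hZ
      rw [Finset.sum_const]
      have he : ∀ k ∈ Z, #(Z.erase k ∩ X) = if k ∈ X then #(Z ∩ X) - 1 else #(Z ∩ X) := by
        intro k hk
        rw [erase_inter]
        split_ifs with hkX
        · exact card_erase_of_mem (mem_inter.2 ⟨hk, hkX⟩)
        · rw [erase_eq_of_notMem (by simp [hkX])]
      have hpos : ∀ k ∈ Z, k ∈ X → 0 < #(Z ∩ X) := fun k hk hkX =>
        card_pos.2 ⟨k, mem_inter.2 ⟨hk, hkX⟩⟩
      by_cases hj0 : #(Z ∩ X) = j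
      · rw [if_pos hj0, if_neg (by omega), add_zero]
        congr 1
        have : (Z.filter fun k => #(Z.erase k ∩ X) = j) = Z \ X := by
          ext k
          simp only [mem_filter, mem_sdiff]
          refine and_congr_right fun hk => ?_
          rw [he k hk]
          split_ifs with hkX
          · have := hpos k hk hkX
            simp only [hkX, not_true_eq_false, iff_false]
            omega
          · simp [hkX, hj0]
        rw [this, card_sdiff, inter_comm, hj0, hZ.2]
      · by_cases hj1 : #(Z ∩ X) = j + 1
        · rw [if_neg hj0, if_pos hj1, zero_add]
          congr 1
          rw [← hj1]
          congr 1
          ext k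
          simp only [mem_filter, mem_inter]
          refine and_congr_right fun hk => ?_
          rw [he k hk]
          split_ifs with hkX
          · simp only [hkX, iff_true]
            omega
          · simp [hkX, hj0]
        · rw [if_neg hj0, if_neg hj1, add_zero, Finset.filter_eq_empty_iff.2, card_empty,
            zero_smul]
          intro k hk
          rw [he k hk]
          split_ifs with hkX
          · have := hpos k hk hkX
            omega
          · exact hj0
    rw [h1, Finset.sum_congr rfl h2, Finset.sum_add_distrib, ← Finset.sum_filter,
      ← Finset.sum_filter, Finset.filter_filter, Finset.filter_filter, ← Finset.smul_sum,
      ← Finset.smul_sum] at h0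
    exact h0
  have hS : ∀ j ≤ #X, S j = 0 := by
    intro j
    induction j with
    | zero =>
      intro _
      refine Finset.sum_eq_zero fun Z hZ => ?_
      simp only [mem_filter, mem_powerset, card_eq_zero] at hZ
      have hd : #(Z ∪ X) = #Z + #X := card_union_of_disjoint (disjoint_iff_inter_eq_empty.2 hZ.2.2)
      have := card_le_card (union_subset hZ.1 hXK)
      omega
    | succ j ih =>
      intro hj
      have := hrec j hj
      rw [ih (by omega), smul_zero, zero_add] at this
      exact (smul_eq_zero.1 this).resolve_left (by omega)
  have hXX := hS #X le_rfl
  have : (K.powerset.filter fun Z => #Z = #X ∧ #(Z ∩ X) = #X) = {X} := by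
    ext Z
    simp only [mem_filter, mem_powerset, mem_singleton]
    constructor
    · rintro ⟨_, hZ, hZX⟩
      have h1 : Z ∩ X = X := eq_of_subset_of_card_le inter_subset_right hZX.ge
      exact (eq_of_subset_of_card_le (h1 ▸ inter_subset_left) hZ.le).symm
    · rintro rfl
      simp [hXK]
  simpa only [S, this, Finset.sum_singleton] using hXX

/-- The `lex`-leading word of a highest weight tensor is a ballot word, read from the right. -/
theorem card_filter_le_of_leading {n N : ℕ} {A : Type*} [AddCommGroup A] [IsAddTorsionFree A]
    (g : (Fin N → Fin n) → A) {i i' : Fin n} (hi : i < i')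
    (hg : ∀ w : Fin N → Fin n, ∑ k with w k = i, g (Function.update w k i') = 0)
    {α : Fin N → Fin n} (hα : g α ≠ 0) (hmax : ∀ w, toLex α < toLex w → g w = 0) (t : Fin N) :
    #{k | t ≤ k ∧ α k = i'} ≤ #{k | t ≤ k ∧ α k = i} := by
  by_contra! hlt
  let K : Finset (Fin N) := {k | t ≤ k ∧ (α k = i ∨ α k = i')}
  let X : Finset (Fin N) := {k | t ≤ k ∧ α k = i'}
  let W : Finset (Fin N) → Fin N → Fin n := fun Y k =>
    if k ∈ K then if k ∈ Y then i' else i else α k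
  have hXK : X ⊆ K := by
    intro k
    simp only [X, K, mem_filter, mem_univ, true_and]
    tauto
  have hWX : W X = α := by
    ext1 k
    by_cases hk : t ≤ k <;> by_cases h1 : α k = i' <;> by_cases h2 : α k = i <;>
      simp_all [W, K, X]
  have hK : #K = #X + #(univ.filter fun k => t ≤ k ∧ α k = i) := by
    rw [← card_union_of_disjoint]
    · congr 1
      ext k
      simp only [X, K, mem_filter, mem_univ, true_and, mem_union]
      tauto
    · rw [disjoint_left]
      intro k
      simp only [X, mem_filter, mem_univ, true_and]
      rintro ⟨-, h1⟩ ⟨-, h2⟩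
      exact hi.ne (h2.symm.trans h1)
  refine hα ?_
  rw [← hWX]
  refine Finset.eq_zero_of_sum_insert_eq_zero K (fun Y => g (W Y)) ?_ hXK ?_
  swap
  · rw [hK, two_mul]
    exact Nat.add_lt_add_left hlt _
  intro Y hY
  rw [← hg (W Y)]
  have hsub : K \ Y ⊆ univ.filter fun k => W Y k = i := by
    intro k hk
    simp only [mem_sdiff] at hk
    simp [W, hk]
  rw [← Finset.sum_subset hsub]
  · refine Finset.sum_congr rfl fun k hk => ?_
    rw [mem_sdiff] at hk
    congr 1
    ext1 l
    by_cases hl : l = k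
    · subst hl
      simp [W, hk.1]
    · simp [W, hl]
  · intro k hk hkY
    simp only [mem_filter, mem_univ, true_and] at hk
    have hkK : k ∉ K := by
      intro hkK
      have hkY' : k ∈ Y := by
        by_contra h
        exact hkY (mem_sdiff.2 ⟨hkK, h⟩)
      simp only [W, hkK, hkY', if_true] at hk
      exact hi.ne' hk
    have hαk : α k = i := by simpa [W, hkK] using hk
    have hkt : k < t := by
      by_contra! hkt
      exact hkK (by simp [K, hkt, hαk])
    refine hmax _ ⟨k, fun l hl => ?_, ?_⟩
    · have hlK : l ∉ K := by
        simp only [K, mem_filter, mem_univ, true_and, not_and]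
        intro h
        exact absurd (hl.trans hkt) (not_lt.2 h)
      change α l = Function.update (W Y) k i' l
      rw [Function.update_of_ne hl.ne]
      simp [W, hlK]
    · change α k < Function.update (W Y) k i' k
      simpa [hαk] using hi

/-- The coefficient of `∏ₖ u (α k) k * v (β k) k` in the determinant with columns `uₖ ⊗ vₖ`. -/
def kroneckerDetCoeff (R : Type*) [CommRing R] {K I J : Type*} [Fintype K] [DecidableEq K]
    [DecidableEq I] [DecidableEq J] (r : K → I × J) (α : K → I) (β : K → J) : R :=
  (of fun l k => if r l = (α k, β k) then (1 : R) else 0).det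

section Coeff

variable {R K I J : Type*} [CommRing R] [Fintype K] [DecidableEq K] [DecidableEq I] [DecidableEq J]

theorem kroneckerDetCoeff_intCast (r : K → I × J) (α : K → I) (β : K → J) :
    ((kroneckerDetCoeff ℤ r α β : ℤ) : R) = kroneckerDetCoeff R r α β := by
  rw [kroneckerDetCoeff, kroneckerDetCoeff, Int.cast_det]
  congr 1
  ext l k
  by_cases h : r l = (α k, β k) <;> simp [h]

theorem kroneckerDetCoeff_swap (r : K → I × J) (α : K → I) (β : K → J) :
    kroneckerDetCoeff R (Prod.swap ∘ r) β α = kroneckerDetCoeff R r α β := by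
  simp only [kroneckerDetCoeff, Function.comp_apply]
  congr 1
  ext l k
  simp only [of_apply, Prod.ext_iff, Prod.fst_swap, Prod.snd_swap, and_comm]

theorem kroneckerDetCoeff_eq_zero (r : K → I × J) {α : K → I} {β : K → J}
    (h : ¬ Function.Injective fun k => (α k, β k)) : kroneckerDetCoeff R r α β = 0 := by
  simp only [Function.Injective, not_forall] at h
  obtain ⟨k, l, hkl, hne⟩ := h
  exact det_zero_of_column_eq hne fun s => by simp [of_apply, hkl]

theorem kroneckerDetCoeff_mul_self (r e : K ≃ I × J) :
    kroneckerDetCoeff ℤ r (fun k => (e k).1) (fun k => (e k).2) *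
      kroneckerDetCoeff ℤ r (fun k => (e k).1) (fun k => (e k).2) = 1 := by
  have : kroneckerDetCoeff ℤ r (fun k => (e k).1) (fun k => (e k).2) =
      Equiv.Perm.sign (r.trans e.symm) := by
    have h := det_permute (r.trans e.symm) (1 : Matrix K K ℤ)
    rw [det_one, mul_one, Int.cast_id] at h
    rw [← h, kroneckerDetCoeff]
    congr 1
    ext l k
    simp [one_apply, Equiv.symm_apply_eq]
  rw [this, ← Units.val_mul, Int.units_mul_self, Units.val_one]

theorem sum_kroneckerDetCoeff_update (r : K ≃ I × J) {i i' : I} (hi : i ≠ i') (w : K → I)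
    (β : K → J) :
    ∑ k with w k = i, kroneckerDetCoeff R r (Function.update w k i') β = 0 := by
  let A : Matrix K K R := of fun l k => if r l = (w k, β k) then 1 else 0
  let X : Matrix K K R := of fun l l' => if r l = (i', (r l').2) ∧ (r l').1 = i then 1 else 0
  have hX : X.trace = 0 := by
    refine Finset.sum_eq_zero fun l _ => ?_
    simp only [X, diag_apply, of_apply]
    rw [if_neg]
    rintro ⟨h1, h2⟩
    exact hi (h2.symm.trans (congrArg Prod.fst h1))
  have hXA : ∀ l k, (X * A) l k = if w k = i ∧ r l = (i', β k) then 1 else 0 := by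
    intro l k
    rw [mul_apply, Finset.sum_eq_single (r.symm (w k, β k))]
    · simp [X, A, and_comm]
    · intro l' _ hl'
      have : r l' ≠ (w k, β k) := fun h => hl' (by rw [← h, r.symm_apply_apply])
      simp [A, this]
    · simp
  have h := Matrix.sum_det_updateCol_mul_s5 X A
  rw [hX, zero_mul] at h
  rw [← h, Finset.sum_filter]
  refine Finset.sum_congr rfl fun k _ => ?_
  split_ifs with hk
  · rw [kroneckerDetCoeff]
    congr 1
    ext l s
    by_cases hs : s = k
    · subst hs
      simp [hXA, hk]
    · simp [hs, A]
  · refine (det_eq_zero_of_column_eq_zero k fun l => ?_).symm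
    simp [hXA, hk]

theorem card_filter_eq_of_kroneckerDetCoeff_ne_zero [Fintype I] [Fintype J] (r : K ≃ I × J)
    {α : K → I} {β : K → J} (h : kroneckerDetCoeff R r α β ≠ 0) (i : I) :
    #{k | α k = i} = Fintype.card J := by
  have hinj : Function.Injective fun k => (α k, β k) := by
    by_contra h'
    exact h (kroneckerDetCoeff_eq_zero r h')
  have hbij := (Fintype.bijective_iff_injective_and_card _).2 ⟨hinj, Fintype.card_congr r⟩
  rw [← card_univ]
  refine card_bij (fun k _ => β k) (fun _ _ => mem_univ _) ?_ ?_
  · intro k hk l hl hkl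
    simp only [mem_filter, mem_univ, true_and] at hk hl
    exact hinj (by simp [hk, hl, hkl])
  · intro j _
    obtain ⟨k, hk⟩ := hbij.2 (i, j)
    simp only [Prod.mk.injEq] at hk
    exact ⟨k, by simp [hk.1], hk.2⟩

theorem det_submatrix_kronecker [Fintype I] [Fintype J] {M P : Type*} (r : K → I × J)
    (φ : Matrix I M R) (ψ : Matrix J P R) (d : K → M × P) :
    ((kroneckerMap (· * ·) φ ψ).submatrix r d).det =
      ∑ α : K → I, (∏ k, φ (α k) (d k).1) *
        ∑ β : K → J, kroneckerDetCoeff R r α β * ∏ k, ψ (β k) (d k).2 := by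
  have h : (kroneckerMap (· * ·) φ ψ).submatrix r d = of fun l k => ∑ i, φ i (d k).1 *
      ∑ j, ψ j (d k).2 * if r l = (i, j) then 1 else 0 := by
    ext l k
    simp [Prod.ext_iff, ite_and]
  rw [h, Matrix.det_of_sum fun l k i => φ i (d k).1 *
      ∑ j, ψ j (d k).2 * if r l = (i, j) then 1 else 0]
  refine Finset.sum_congr rfl fun α _ => ?_
  have h1 := det_mul_row (fun k => φ (α k) (d k).1)
    (of fun l k => ∑ j, ψ j (d k).2 * if r l = (α k, j) then 1 else 0)
  simp only [of_apply] at h1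
  rw [h1, Matrix.det_of_sum fun l k j => ψ j (d k).2 * if r l = (α k, j) then 1 else 0]
  congr 1
  refine Finset.sum_congr rfl fun β _ => ?_
  rw [mul_comm, kroneckerDetCoeff, ← det_mul_row]
  rfl

end Coeff

theorem det_submatrix_mem_minorsIdeal {R N M : Type*} [CommRing R] (t : ℕ) (A : Matrix N M R)
    (s : Fin t → N) (c : Fin t → M) : (A.submatrix s c).det ∈ minorsIdeal t A :=
  Ideal.subset_span ⟨s, c, rfl⟩

theorem sum_kroneckerDetCoeff_mul_prod_mem {R K : Type*} [CommRing R] [Fintype K] [DecidableEq K]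
    {n q p : ℕ} (r : K ≃ Fin n × Fin q) (ψ : Matrix (Fin q) (Fin p) R) (b : K → Fin p)
    (α : K → Fin n) :
    ∑ β : K → Fin q, kroneckerDetCoeff R r α β * ∏ k, ψ (β k) (b k) ∈ minorsIdeal q ψ ^ n := by
  by_cases h : ∃ β : K → Fin q, Function.Injective fun k => (α k, β k)
  · obtain ⟨β₀, hβ₀⟩ := h
    let e : K ≃ Fin n × Fin q := Equiv.ofBijective _
      ((Fintype.bijective_iff_injective_and_card _).2 ⟨hβ₀, Fintype.card_congr r⟩)
    have hsum : ∑ β : K → Fin q, kroneckerDetCoeff R r α β * ∏ k, ψ (β k) (b k) =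
        (of fun l k => if (r l).1 = α k then ψ (r l).2 (b k) else 0).det := by
      have : (of fun l k => if (r l).1 = α k then ψ (r l).2 (b k) else 0) =
          of fun l k => ∑ j, ψ j (b k) * if r l = (α k, j) then 1 else 0 := by
        ext l k
        by_cases hl : (r l).1 = α k <;> simp [hl, Prod.ext_iff]
      rw [this, Matrix.det_of_sum fun l k j => ψ j (b k) * if r l = (α k, j) then 1 else 0]
      refine Finset.sum_congr rfl fun β _ => ?_
      rw [mul_comm, kroneckerDetCoeff, ← det_mul_row]
      rfl
    have hdet : (of fun l k => if (r l).1 = α k then ψ (r l).2 (b k) else 0).det =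
        ((of fun l k => if (r l).1 = α k then ψ (r l).2 (b k) else 0).submatrix
          (e.trans r.symm) id).det *
          ((Equiv.Perm.sign (e.trans r.symm) : ℤ) : R) := by
      rw [det_permute, mul_right_comm, ← Int.cast_mul, ← Units.val_mul,
        Int.units_mul_self]
      simp
    have hblock : (of fun l k => if (r l).1 = α k then ψ (r l).2 (b k) else 0).submatrix
          (e.trans r.symm) id =
        (blockDiagonal fun i => ψ.submatrix id fun j => b (e.symm (i, j))).submatrix
          (e.trans (Equiv.prodComm _ _)) (e.trans (Equiv.prodComm _ _)) := by
      ext l k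
      have hk : b (e.symm ((e k).1, (e k).2)) = b k := by simp
      have hα : (e k).1 = α k := rfl
      by_cases h : (e l).1 = α k
      · simp only [← hα] at h
        simp [blockDiagonal_apply, ← hα, h]
      · simp [blockDiagonal_apply, hα, h]
    rw [hsum, hdet, hblock, det_submatrix_equiv_self, det_blockDiagonal]
    refine Ideal.mul_mem_right _ _ ?_
    have := Ideal.prod_mem_prod (s := (univ : Finset (Fin n))) (I := fun _ => minorsIdeal q ψ)
      fun i _ => det_submatrix_mem_minorsIdeal q ψ id fun j => b (e.symm (i, j))
    simpa using this
  · rw [Finset.sum_eq_zero]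
    · exact zero_mem _
    · intro β _
      rw [kroneckerDetCoeff_eq_zero r fun hβ => h ⟨β, hβ⟩, zero_mul]

/-- Ballot words are the leading words of products of brackets. -/
theorem exists_kroneckerDetCoeff_leading {n q : ℕ} (r : Fin (n * q) ≃ Fin n × Fin q)
    {α : Fin (n * q) → Fin n} (hcard : ∀ i, #{k | α k = i} = q)
    (hα : ∀ i i', i < i' → ∀ t, #{k | t ≤ k ∧ α k = i'} ≤ #{k | t ≤ k ∧ α k = i}) :
    ∃ β : Fin (n * q) → Fin q,
      kroneckerDetCoeff ℤ r α β * kroneckerDetCoeff ℤ r α β = 1 ∧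
      ∀ w, toLex α < toLex w → kroneckerDetCoeff ℤ r w β = 0 := by
  have hlt : ∀ k, #{l | k < l ∧ α l = α k} < q := by
    intro k
    refine lt_of_lt_of_eq (card_lt_card ⟨?_, ?_⟩) (hcard (α k))
    · intro l
      simp
    · intro hsub
      have := hsub (show k ∈ _ by simp)
      simp at this
  have hle : ∀ k, #{l | k ≤ l ∧ α l = α k} = #{l | k < l ∧ α l = α k} + 1 := by
    intro k
    rw [← card_insert_of_notMem (a := k) (by simp)]
    congr 1
    ext l
    simp only [mem_filter, mem_univ, true_and, mem_insert, le_iff_eq_or_lt]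
    constructor
    · rintro ⟨rfl | h, h'⟩
      · exact Or.inl rfl
      · exact Or.inr ⟨h, h'⟩
    · rintro (rfl | ⟨h, h'⟩)
      · exact ⟨Or.inl rfl, rfl⟩
      · exact ⟨Or.inr h, h'⟩
  let β : Fin (n * q) → Fin q := fun k => ⟨_, hlt k⟩
  have hmono : ∀ k l, k < l → α k = α l → β l < β k := by
    intro k l hkl h
    change #{s | l < s ∧ α s = α l} < #{s | k < s ∧ α s = α k}
    rw [Nat.lt_iff_add_one_le, ← hle l]
    refine card_le_card fun s => ?_
    simp only [mem_filter, mem_univ, true_and, h]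
    exact fun hs => ⟨hkl.trans_le hs.1, hs.2⟩
  have hinj : Function.Injective fun k => (α k, β k) := by
    intro k l hkl
    simp only [Prod.mk.injEq] at hkl
    rcases lt_trichotomy k l with h | h | h
    · exact absurd hkl.2 (hmono k l h hkl.1).ne'
    · exact h
    · exact absurd hkl.2 (hmono l k h hkl.1.symm).ne
  let e : Fin (n * q) ≃ Fin n × Fin q := Equiv.ofBijective _
    ((Fintype.bijective_iff_injective_and_card _).2 ⟨hinj, Fintype.card_congr r⟩)
  refine ⟨β, kroneckerDetCoeff_mul_self r e, ?_⟩
  rintro w ⟨k, hk, hkw⟩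
  change ∀ l < k, α l = w l at hk
  change α k < w k at hkw
  refine kroneckerDetCoeff_eq_zero r fun hw => ?_
  obtain ⟨s, hs⟩ := e.surjective (w k, β k)
  have hs1 : α s = w k := congrArg Prod.fst hs
  have hs2 : β s = β k := congrArg Prod.snd hs
  have hsk : s < k := by
    by_contra! hks
    have hne : k ≠ s := by
      rintro rfl
      exact hkw.ne hs1
    have hlt : k < s := lt_of_le_of_ne hks hne
    have h1 := hα _ _ hkw s
    rw [← hs1, hle s] at h1
    have h2 : #{l | s ≤ l ∧ α l = α k} ≤ #{l | k < l ∧ α l = α k} := by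
      refine card_le_card fun l => ?_
      simp only [mem_filter, mem_univ, true_and]
      exact fun hl => ⟨hlt.trans_le hl.1, hl.2⟩
    have h3 : #{l | s < l ∧ α l = α s} = #{l | k < l ∧ α l = α k} := congrArg Fin.val hs2
    omega
  exact hsk.ne (hw (by simp only [← hk s hsk, hs1, hs2]))

/-- A highest weight tensor is a combination of products of brackets, with coefficients in the
span of its coordinates. -/
theorem sum_mul_mem_of_highestWeight {R A : Type*} [CommRing R] [AddCommGroup A]
    [IsAddTorsionFree A] {n q : ℕ} (r : Fin (n * q) ≃ Fin n × Fin q)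
    (c : (Fin (n * q) → Fin n) → R) (Φ : A →+ R) (I J : Ideal R)
    (hc : ∀ β, ∑ α, kroneckerDetCoeff R r α β * c α ∈ I)
    (g : (Fin (n * q) → Fin n) → A) (hJ : ∀ α, Φ (g α) ∈ J)
    (hcard : ∀ α, g α ≠ 0 → ∀ i, #{k | α k = i} = q)
    (hg : ∀ i i', i < i' → ∀ w : Fin (n * q) → Fin n,
      ∑ k with w k = i, g (Function.update w k i') = 0) :
    ∑ α, c α * Φ (g α) ∈ I * J := by
  suffices key : ∀ (z : WithTop (Lex (Fin (n * q) → Fin n))) (g : (Fin (n * q) → Fin n) → A),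
      (∀ α, Φ (g α) ∈ J) → (∀ α, g α ≠ 0 → ∀ i, #{k | α k = i} = q) →
      (∀ i i', i < i' → ∀ w : Fin (n * q) → Fin n,
        ∑ k with w k = i, g (Function.update w k i') = 0) →
      (∀ w, g w ≠ 0 → ((toLex w : Lex (Fin (n * q) → Fin n)) : WithTop _) < z) →
      ∑ α, c α * Φ (g α) ∈ I * J from
    key ⊤ g hJ hcard hg fun w _ => WithTop.coe_lt_top _
  clear hg hcard hJ g
  intro z
  induction z using WellFoundedLT.induction with
  | ind z ih =>
  intro g hJ hcard hg hz
  classical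
  by_cases h0 : ∀ w, g w = 0
  · simp [h0]
  push Not at h0
  obtain ⟨w, hw⟩ := h0
  obtain ⟨α, hα, hαmax⟩ := Finset.exists_max_image (univ.filter fun w => g w ≠ 0) toLex
    ⟨w, by simpa using hw⟩
  simp only [mem_filter, mem_univ, true_and] at hα hαmax
  have hlead : ∀ w, toLex α < toLex w → g w = 0 := fun w hw => by
    by_contra h
    exact absurd (hαmax w h) (not_le.2 hw)
  obtain ⟨β, hβ, hβlt⟩ := exists_kroneckerDetCoeff_leading r (hcard _ hα) fun i i' hi t =>
    card_filter_le_of_leading g hi (hg i i' hi) hα hlead t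
  let a : A := kroneckerDetCoeff ℤ r α β • g α
  have ha : Φ a ∈ J := by
    rw [map_zsmul]
    exact zsmul_mem (hJ α) _
  have hrest := ih _ (hz α hα) (fun w => g w - kroneckerDetCoeff ℤ r w β • a) ?_ ?_ ?_ ?_
  · have hsum : ∑ w, c w * Φ (g w) =
        ∑ w, c w * Φ (g w - kroneckerDetCoeff ℤ r w β • a) +
          (∑ w, kroneckerDetCoeff R r w β * c w) * Φ a := by
      rw [Finset.sum_mul, ← Finset.sum_add_distrib]
      refine Finset.sum_congr rfl fun w _ => ?_
      rw [map_sub, map_zsmul, zsmul_eq_mul, kroneckerDetCoeff_intCast]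
      ring
    rw [hsum]
    exact add_mem hrest (Ideal.mul_mem_mul (hc β) ha)
  · intro w
    rw [map_sub, map_zsmul]
    exact sub_mem (hJ w) (zsmul_mem ha _)
  · intro w hw
    by_cases hgw : g w = 0
    · simpa using card_filter_eq_of_kroneckerDetCoeff_ne_zero r (α := w) (β := β) (R := ℤ)
        fun h => hw (by simp [hgw, h])
    · exact hcard w hgw
  · intro i i' hi w
    rw [Finset.sum_sub_distrib, hg i i' hi w, ← Finset.sum_smul,
      sum_kroneckerDetCoeff_update r hi.ne, zero_smul, sub_zero]
  · intro w hw
    rw [WithTop.coe_lt_coe]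
    by_contra! hle
    refine hw ?_
    rcases hle.lt_or_eq with h | h
    · simp [hlead w h, hβlt w h]
    · obtain rfl : α = w := toLex.injective h
      simp [a, smul_smul, hβ]

end MinorsKronecker

open scoped Kronecker in
/-- For a commutative ring `R` and linear maps `φ : R^m → R^n`, `ψ : R^p → R^q`,
`I(φ ⊗ ψ) ⊆ I(φ)^q · I(ψ)^n`, where `I(φ ⊗ ψ)` is the ideal of minors of size `n·q` of the
tensor (Kronecker) product map. -/
theorem maximalMinors_kronecker_subset {R : Type*} [CommRing R] {m n p q : ℕ}
    (φ : Matrix (Fin n) (Fin m) R) (ψ : Matrix (Fin q) (Fin p) R) :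
    minorsIdeal (n * q) (φ ⊗ₖ ψ) ≤ minorsIdeal n φ ^ q * minorsIdeal q ψ ^ n := by
  refine Ideal.span_le.2 ?_
  rintro _ ⟨s, d, rfl⟩
  by_cases hs : Function.Injective s
  · let r : Fin (n * q) ≃ Fin n × Fin q := Equiv.ofBijective s
      ((Fintype.bijective_iff_injective_and_card _).2 ⟨hs, by simp⟩)
    rw [SetLike.mem_coe, show s = r from rfl, det_submatrix_kronecker r]
    let Φ : ((Fin (n * q) → Fin q) → ℤ) →+ R :=
      { toFun := fun h => ∑ β, (h β : R) * ∏ k, ψ (β k) (d k).2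
        map_zero' := by simp
        map_add' := fun h h' => by simp [add_mul, Finset.sum_add_distrib] }
    have hΦ : ∀ α, Φ (fun β => kroneckerDetCoeff ℤ r α β) =
        ∑ β : Fin (n * q) → Fin q, kroneckerDetCoeff R r α β * ∏ k, ψ (β k) (d k).2 := fun α => by
      simp [Φ, kroneckerDetCoeff_intCast]
    simp only [← hΦ]
    refine sum_mul_mem_of_highestWeight r _ Φ _ _ ?_ _ ?_ ?_ ?_
    · intro β
      have := sum_kroneckerDetCoeff_mul_prod_mem (r.trans (Equiv.prodComm _ _)) φ
        (fun k => (d k).1) β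
      simpa only [Equiv.coe_trans, Equiv.coe_prodComm, kroneckerDetCoeff_swap] using this
    · intro α
      rw [hΦ]
      exact sum_kroneckerDetCoeff_mul_prod_mem r ψ _ α
    · intro α hα
      obtain ⟨β, hβ⟩ := Function.ne_iff.1 hα
      simpa using card_filter_eq_of_kroneckerDetCoeff_ne_zero r hβ
    · intro i i' hi w
      ext β
      simpa using sum_kroneckerDetCoeff_update (R := ℤ) r hi.ne w β
  · simp only [Function.Injective, not_forall] at hs
    obtain ⟨k, l, hkl, hne⟩ := hs
    rw [Matrix.det_zero_of_row_eq hne (by ext x; simp [hkl])]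
    exact zero_mem _
end
end

section
/- Let R be a commutative ring, let φ : R^m → R^n be an R-linear map, and let 1 ≤ d ≤ n. Then the integral closure of the ideal I(⋀^d(φ)) equals the integral closure of the ideal I(φ)^e, where e = binomial(n-1, d-1). -/
noncomputable section

/-- The integral closure of an ideal `I ⊆ R`: the set of `x ∈ R` satisfying an equation
`x^k + a_1 x^{k-1} + ⋯ + a_k = 0` with `a_i ∈ I^i` for all `i`. -/
def Ideal.intClosure {R : Type*} [CommRing R] (I : Ideal R) : Set R :=
  {x : R | ∃ k : ℕ, 0 < k ∧ ∃ a : ℕ → R, (∀ i ∈ Finset.Icc 1 k, a i ∈ I ^ i) ∧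
      x ^ k + ∑ i ∈ Finset.Icc 1 k, a i * x ^ (k - i) = 0}


open Polynomial in
theorem Ideal.mem_intClosure_of_monic {R : Type*} [CommRing R] {I : Ideal R} {x : R} (p : R[X])
    (hp : p.Monic) (hx : p.eval x = 0) (hc : ∀ i, p.coeff i ∈ I ^ (p.natDegree - i)) :
    x ∈ I.intClosure := by
  refine ⟨p.natDegree + 1, by omega,
    fun i => if i ≤ p.natDegree then p.coeff (p.natDegree - i) else 0, fun i _ => ?_, ?_⟩
  · dsimp only
    split_ifs with h
    · simpa [Nat.sub_sub_self h] using hc (p.natDegree - i)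
    · exact zero_mem _
  · have h := congrArg (x * ·) hx
    simp only [eval_eq_sum_range, mul_zero, Finset.sum_range_succ, hp.coeff_natDegree] at h
    refine Eq.trans ?_ h
    rw [Finset.sum_Icc_succ_top (by omega)]
    dsimp only
    rw [if_neg (by omega), zero_mul, add_zero, mul_add,
      one_mul, ← pow_succ', add_comm, Finset.mul_sum]
    congr 1
    refine Finset.sum_nbij' (p.natDegree - ·) (p.natDegree - ·) ?_ ?_ ?_ ?_ fun i hi => ?_
    any_goals simp only [Finset.mem_Icc, Finset.mem_range]; omega
    have hi := (Finset.mem_Icc.1 hi).2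
    rw [if_pos hi, Nat.sub_add_comm hi, pow_succ]
    ring

theorem Ideal.mem_intClosure_of_pow_mem {R : Type*} [CommRing R] {I : Ideal R} {x : R} {k : ℕ}
    (hk : 0 < k) (hx : x ^ k ∈ I ^ k) : x ∈ I.intClosure := by
  refine ⟨k, hk, fun i => if i = k then -x ^ k else 0, fun i _ => ?_, ?_⟩
  · dsimp only
    split_ifs with h
    · subst h; exact neg_mem hx
    · exact zero_mem _
  · rw [Finset.sum_eq_single k]
    · simp
    · intro i _ hi; simp [hi]
    · intro h; exact absurd (Finset.mem_Icc.2 ⟨hk, le_rfl⟩) h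

theorem Ideal.map_mem_intClosure {R S : Type*} [CommRing R] [CommRing S] (f : R →+* S)
    {I : Ideal R} {J : Ideal S} (hIJ : I.map f ≤ J) {x : R} (hx : x ∈ I.intClosure) :
    f x ∈ J.intClosure := by
  obtain ⟨k, hk, a, ha, h⟩ := hx
  refine ⟨k, hk, f ∘ a, fun i hi => ?_, ?_⟩
  · have := Ideal.mem_map_of_mem f (ha i hi)
    rw [Ideal.map_pow] at this
    exact Ideal.pow_right_mono hIJ i this
  · simpa using congrArg f h

open Polynomial in
theorem IsIntegral.of_pow_add_sum_eq_zero {A B : Type*} [CommRing A] [CommRing B] [Algebra A B]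
    {y : B} {k : ℕ} (b : ℕ → A)
    (h : y ^ k + ∑ i ∈ Finset.Icc 1 k, algebraMap A B (b i) * y ^ (k - i) = 0) :
    IsIntegral A y := by
  nontriviality A
  refine ⟨X ^ k + ∑ i ∈ Finset.Icc 1 k, C (b i) * X ^ (k - i), monic_X_pow_add ?_, ?_⟩
  · refine (degree_sum_le _ _).trans_lt ((Finset.sup_lt_iff (by simp)).2 fun i hi => ?_)
    rw [Finset.mem_Icc] at hi
    refine (degree_C_mul_X_pow_le _ _).trans_lt ?_
    exact_mod_cast (by omega : k - i < k)
  · simpa [eval₂_finsetSum] using h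

open Polynomial in
theorem Ideal.intClosure_span_subset {R : Type*} [CommRing R] {I : Ideal R} {s : Set R}
    (hs : s ⊆ I.intClosure) : (Ideal.span s).intClosure ⊆ I.intClosure := by
  let A := Algebra.adjoin R {C r * X | r ∈ I}
  have key : ∀ (B : Subalgebra A R[X]) (J : Ideal R), (∀ r ∈ J, C r * X ∈ B) →
      ∀ x ∈ J.intClosure, IsIntegral B (C x * X) := by
    rintro B J hJ x ⟨k, -, a, ha, h⟩
    have hmon : ∀ i ∈ Finset.Icc 1 k, monomial i (a i) ∈ B := fun i hi => by
      refine (Algebra.adjoin_le (S := B.restrictScalars R) ?_)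
        (monomial_mem_adjoin_monomial (ha i hi))
      rintro _ ⟨r, hr, rfl⟩
      simpa [C_mul_X_eq_monomial] using hJ r hr
    refine IsIntegral.of_pow_add_sum_eq_zero (k := k)
      (fun i => if hi : i ∈ Finset.Icc 1 k then ⟨monomial i (a i), hmon i hi⟩ else 0) ?_
    have h' := congrArg (monomial k) h
    rw [map_add, map_sum, map_zero] at h'
    rw [← h']
    congr 1
    · simp [C_mul_X_eq_monomial, monomial_pow]
    · refine Finset.sum_congr rfl fun i hi => ?_
      have := (Finset.mem_Icc.1 hi).2
      rw [dif_pos hi, C_mul_X_eq_monomial, monomial_pow]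
      refine (monomial_mul_monomial _ _ _ _).trans ?_
      rw [one_mul, Nat.add_sub_cancel' this]
  have hA : ∀ r ∈ I.intClosure, C r * X ∈ integralClosure A R[X] := fun r hr => by
    refine isIntegral_trans (A := (⊥ : Subalgebra A R[X])) _ (key ⊥ I (fun r hr => ?_) r hr)
    exact Subalgebra.algebraMap_mem ⊥ (⟨C r * X, Algebra.subset_adjoin ⟨r, hr, rfl⟩⟩ : A)
  intro x hx
  have h_int := key (integralClosure A R[X]) (span s) (fun r hr => ?_) x hx
  · have : IsIntegral A (C x * X) := isIntegral_trans (A := integralClosure A R[X]) _ h_int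
    obtain ⟨q, hq, hq0⟩ := this
    obtain ⟨p, hp, h0, hc⟩ := exists_monic_aeval_eq_zero_forall_mem_pow_of_isIntegral
      (R := R) (S := R) (I := I) (x := x) ⟨q, hq, by
        rw [← hq0]
        congr 1
        ext1 z
        exact congrArg (fun f : R[X] →+* R[X] => f z) mapRingHom_id⟩
    exact mem_intClosure_of_monic p hp h0 hc
  · induction hr using Submodule.span_induction with
    | mem r hr => exact hA r (hs hr)
    | zero => simp
    | add a b _ _ ha hb => rw [map_add, add_mul]; exact add_mem ha hb
    | smul a b _ hb =>
      rw [smul_eq_mul, map_mul, mul_assoc]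
      exact mul_mem (Subalgebra.algebraMap_mem (integralClosure A R[X]) (algebraMap R A a)) hb

theorem Ideal.mem_intClosure_of_mul_mem {R : Type*} [CommRing R] [IsDomain R] {I J : Ideal R}
    (hJ : J.FG) (hJ0 : J ≠ ⊥) {y : R} (hy : ∀ z ∈ J, y * z ∈ I * J) : y ∈ I.intClosure := by
  have : Module.Finite R J := Module.Finite.iff_fg.2 hJ
  obtain ⟨p, hp, -, hc, h0⟩ :=
    LinearMap.exists_monic_and_natDegree_eq_and_coeff_mem_pow_and_aeval_eq_zero R
      (algebraMap R (Module.End R J) y) I (by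
        rintro _ ⟨z, rfl⟩
        have hIJ : I * J = (I • (⊤ : Submodule R J)).map J.subtype := by
          rw [Submodule.map_smul'', Submodule.map_subtype_top, smul_eq_mul]
        obtain ⟨w, hw, hwz⟩ := hIJ ▸ hy z z.2
        have hwz' : w = algebraMap R (Module.End R J) y z := Subtype.ext hwz
        exact hwz' ▸ hw)
  refine mem_intClosure_of_monic p hp ?_ hc
  obtain ⟨z, hz, hz0⟩ := Submodule.exists_mem_ne_zero_of_ne_bot hJ0
  rw [Polynomial.aeval_algebraMap_apply] at h0
  have := congrArg Subtype.val (LinearMap.congr_fun h0 ⟨z, hz⟩)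
  simpa [hz0] using this

theorem extPowMatrix_eq_toMatrix {R : Type*} [CommRing R] {m n : ℕ} (d : ℕ)
    (A : Matrix (Fin n) (Fin m) R) :
    extPowMatrix d A = LinearMap.toMatrix ((Pi.basisFun R (Fin m)).exteriorPower d)
      ((Pi.basisFun R (Fin n)).exteriorPower d) (exteriorPower.map d A.toLin') := by
  have h (S : Set.powersetCard (Fin n) d) (T : Set.powersetCard (Fin m) d) :
      LinearMap.toMatrix ((Pi.basisFun R (Fin m)).exteriorPower d)
        ((Pi.basisFun R (Fin n)).exteriorPower d) (exteriorPower.map d A.toLin') S T =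
        extPowMatrix d A ⟨S.1, S.2⟩ ⟨T.1, T.2⟩ := by
    rw [LinearMap.toMatrix_apply, exteriorPower.basis_repr_apply, exteriorPower.basis_apply,
      exteriorPower.ιMulti_family, exteriorPower.map_apply_ιMulti,
      exteriorPower.ιMultiDual_apply_ιMulti, ← Matrix.det_transpose]
    congr 1
    ext i j
    simp [Set.powersetCard.ofFinEmbEquiv_symm_apply]
  exact Matrix.ext fun S T => (h S T).symm

theorem extPowMatrix_mul {R : Type*} [CommRing R] {l m n : ℕ} (d : ℕ)
    (A : Matrix (Fin n) (Fin m) R) (B : Matrix (Fin m) (Fin l) R) :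
    extPowMatrix d (A * B) = extPowMatrix d A * extPowMatrix d B := by
  simp only [extPowMatrix_eq_toMatrix, Matrix.toLin'_mul, exteriorPower.map_comp]
  exact LinearMap.toMatrix_comp _ _ _ _ _

theorem extPowMatrix_map {R S : Type*} [CommRing R] [CommRing S] (f : R →+* S) {m n : ℕ} (d : ℕ)
    (A : Matrix (Fin n) (Fin m) R) : extPowMatrix d (A.map f) = (extPowMatrix d A).map f := by
  ext S T
  simp only [extPowMatrix, Matrix.map_apply, RingHom.map_det]
  rfl

theorem extPowMatrix_smul {R : Type*} [CommRing R] {m n : ℕ} (d : ℕ) (c : R)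
    (A : Matrix (Fin n) (Fin m) R) : extPowMatrix d (c • A) = c ^ d • extPowMatrix d A := by
  ext S T
  simp [extPowMatrix, Matrix.submatrix_smul]

theorem extPowMatrix_diagonal {R : Type*} [CommRing R] {n : ℕ} (d : ℕ) (D : Fin n → R) :
    extPowMatrix d (Matrix.diagonal D) = Matrix.diagonal fun S => ∏ i ∈ S.1, D i := by
  ext S T
  by_cases h : S = T
  · subst h
    rw [Matrix.diagonal_apply_eq, extPowMatrix,
      Matrix.submatrix_diagonal _ _ (S.1.orderEmbOfFin S.2).injective, Matrix.det_diagonal]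
    conv_rhs => rw [← Finset.map_orderEmbOfFin_univ S.1 S.2, Finset.prod_map]
    rfl
  · rw [Matrix.diagonal_apply_ne _ h]
    obtain ⟨a, haS, haT⟩ := (Set.powersetCard.exists_mem_notMem_iff_ne S T).1 h
    obtain ⟨k, rfl⟩ := (Set.powersetCard.mem_range_ofFinEmbEquiv_symm_iff_mem S a).2 haS
    refine Matrix.det_eq_zero_of_row_eq_zero k fun j => Matrix.diagonal_apply_ne _ ?_
    intro he
    apply haT
    refine (Set.powersetCard.mem_range_ofFinEmbEquiv_symm_iff_mem T _).1 ⟨j, ?_⟩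
    exact he.symm

theorem Finset.card_filter_mem_subtype_card {n d : ℕ} (hd : 1 ≤ d) (i : Fin n) :
    (Finset.univ.filter fun S : {s : Finset (Fin n) // s.card = d} => i ∈ S.1).card =
      (n - 1).choose (d - 1) := by
  have h : (Finset.powersetCard (d - 1) (Finset.univ.erase i)).card = (n - 1).choose (d - 1) := by
    simp
  rw [← h]
  have hi : ∀ s ∈ Finset.powersetCard (d - 1) (Finset.univ.erase i), i ∉ s := fun s hs his =>
    Finset.notMem_erase i _ ((Finset.mem_powersetCard.1 hs).1 his)
  symm
  refine Finset.card_bij (fun s hs => ⟨insert i s, ?_⟩) (fun s hs => ?_) (fun s hs t ht hst => ?_)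
    (fun S hS => ⟨S.1.erase i, ?_, ?_⟩)
  · rw [Finset.card_insert_of_notMem (hi s hs), (Finset.mem_powersetCard.1 hs).2]
    omega
  · simp
  · rw [← Finset.erase_insert (hi s hs), ← Finset.erase_insert (hi t ht),
      show insert i s = insert i t from congrArg Subtype.val hst]
  · have hiS : i ∈ S.1 := by simpa using hS
    rw [Finset.mem_powersetCard, Finset.card_erase_of_mem hiS, S.2]
    exact ⟨Finset.erase_subset_erase i (Finset.subset_univ _), rfl⟩
  · exact Subtype.ext (Finset.insert_erase (by simpa using hS))

theorem det_extPowMatrix_diagonal {R : Type*} [CommRing R] {n d : ℕ} (hd : 1 ≤ d)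
    (D : Fin n → R) : (extPowMatrix d (Matrix.diagonal D)).det =
      (Matrix.diagonal D).det ^ (n - 1).choose (d - 1) := by
  rw [extPowMatrix_diagonal, Matrix.det_diagonal, Matrix.det_diagonal, ← Finset.prod_pow]
  have h (i : Fin n) : D i ^ (n - 1).choose (d - 1) =
      ∏ S : {s : Finset (Fin n) // s.card = d}, if i ∈ S.1 then D i else 1 := by
    rw [← Finset.card_filter_mem_subtype_card hd i, ← Finset.prod_const, Finset.prod_filter]
  simp_rw [h]
  rw [Finset.prod_comm]
  refine Finset.prod_congr rfl fun S _ => ?_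
  rw [Finset.prod_ite_mem, Finset.univ_inter]

theorem det_extPowMatrix_transvection {K : Type*} [Field K] [CharZero K] {n : ℕ} (d : ℕ)
    {i j : Fin n} (hij : i ≠ j) (c : K) :
    (extPowMatrix d (Matrix.transvection i j c)).det = 1 := by
  let f : Matrix (Fin n) (Fin n) K → K := fun A => (extPowMatrix d A).det
  have hf : ∀ A B, f (A * B) = f A * f B := fun A B => by
    simp only [f, extPowMatrix_mul, Matrix.det_mul]
  have h1 : f 1 = 1 := by
    simp only [f, ← Matrix.diagonal_one, extPowMatrix_diagonal]
    simp
  have hconj : f (Matrix.transvection i j (2 * c)) = f (Matrix.transvection i j c) := by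
    let D : Fin n → K := fun a => if a = i then 2 else 1
    have hD : Matrix.diagonal D * Matrix.transvection i j c =
        Matrix.transvection i j (2 * c) * Matrix.diagonal D := by
      ext a b
      simp only [D, Matrix.diagonal_mul, Matrix.mul_diagonal, Matrix.transvection,
        Matrix.add_apply, Matrix.one_apply, Matrix.single_apply]
      grind
    have hD' : f (Matrix.diagonal D) * f (Matrix.diagonal D⁻¹) = 1 := by
      rw [← hf, Matrix.diagonal_mul_diagonal, ← h1, ← Matrix.diagonal_one]
      congr 2
      ext a
      by_cases ha : a = i <;> simp [D, ha]
    have := congrArg f hD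
    rw [hf, hf, mul_comm] at this
    exact (mul_right_cancel₀ (left_ne_zero_of_mul_eq_one hD') this).symm
  rw [two_mul, ← Matrix.transvection_mul_transvection_same i j hij, hf] at hconj
  have hinv : f (Matrix.transvection i j c) * f (Matrix.transvection i j (-c)) = 1 := by
    rw [← hf, Matrix.transvection_mul_transvection_same i j hij, add_neg_cancel,
      Matrix.transvection_zero, h1]
  exact mul_eq_left₀ (left_ne_zero_of_mul_eq_one hinv) |>.1 hconj

theorem det_extPowMatrix_of_charZero {K : Type*} [Field K] [CharZero K] {n d : ℕ} (hd : 1 ≤ d)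
    (A : Matrix (Fin n) (Fin n) K) :
    (extPowMatrix d A).det = A.det ^ (n - 1).choose (d - 1) := by
  refine Matrix.diagonal_transvection_induction
    (fun A => (extPowMatrix d A).det = A.det ^ (n - 1).choose (d - 1)) A
    (fun D _ => det_extPowMatrix_diagonal hd D) (fun t => ?_) fun B C hB hC => ?_
  · rw [Matrix.TransvectionStruct.det, one_pow]
    exact det_extPowMatrix_transvection d t.hij t.c
  · rw [extPowMatrix_mul, Matrix.det_mul, hB, hC, Matrix.det_mul, mul_pow]

theorem det_extPowMatrix_map {R S : Type*} [CommRing R] [CommRing S] (f : R →+* S) {n : ℕ} (d : ℕ)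
    (A : Matrix (Fin n) (Fin n) R) : (extPowMatrix d (A.map f)).det = f (extPowMatrix d A).det := by
  rw [extPowMatrix_map, RingHom.map_det, RingHom.mapMatrix_apply]

/-- The **Sylvester–Franke theorem**. -/
theorem det_extPowMatrix {R : Type*} [CommRing R] {n d : ℕ} (hd : 1 ≤ d)
    (A : Matrix (Fin n) (Fin n) R) :
    (extPowMatrix d A).det = A.det ^ (n - 1).choose (d - 1) := by
  let P := MvPolynomial (Fin n × Fin n) ℤ
  let X : Matrix (Fin n) (Fin n) P := Matrix.mvPolynomialX _ _ ℤ
  have hX : (extPowMatrix d X).det = X.det ^ (n - 1).choose (d - 1) := by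
    apply IsFractionRing.injective P (FractionRing P)
    rw [map_pow, ← det_extPowMatrix_map, RingHom.map_det, RingHom.mapMatrix_apply,
      det_extPowMatrix_of_charZero hd]
  let f : P →+* R := (MvPolynomial.aeval fun p : Fin n × Fin n => A p.1 p.2).toRingHom
  have hf : X.map f = A := by
    ext i j
    exact MvPolynomial.aeval_X _ _
  rw [← hf, det_extPowMatrix_map, hX, map_pow, RingHom.map_det, RingHom.mapMatrix_apply]

theorem Matrix.det_mem_ideal_pow {R ι : Type*} [CommRing R] [Fintype ι] [DecidableEq ι]
    {I : Ideal R} {A : Matrix ι ι R} (hA : ∀ i j, A i j ∈ I) : A.det ∈ I ^ Fintype.card ι := by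
  rw [Matrix.det_apply']
  refine sum_mem fun σ _ => Ideal.mul_mem_left _ _ ?_
  simpa using Ideal.prod_mem_prod (s := Finset.univ) (I := fun _ => I)
    fun i _ => hA (σ i) i

theorem minorsIdeal_eq_span_range {R N M : Type*} [CommRing R] {t : ℕ} (e : Fin t ≃ N)
    (A : Matrix N M R) :
    minorsIdeal t A = Ideal.span (Set.range fun c : Fin t → M => (A.submatrix e c).det) := by
  refine le_antisymm (Ideal.span_le.2 ?_) (Ideal.span_mono ?_)
  · rintro _ ⟨r, c, rfl⟩
    have h : A.submatrix r c =
        (1 : Matrix (Fin t) (Fin t) R).submatrix (e.symm ∘ r) id * A.submatrix e c := by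
      ext i j
      simp [Matrix.mul_apply, Matrix.one_apply]
    rw [h, Matrix.det_mul]
    exact Ideal.mul_mem_left _ _ (Ideal.subset_span ⟨c, rfl⟩)
  · rintro _ ⟨c, rfl⟩
    exact ⟨e, c, rfl⟩

theorem Matrix.det_mul_eq_sum_prod_mul_det {R N M : Type*} [CommRing R] [Fintype N] [DecidableEq N]
    [Fintype M] (A : Matrix N M R) (B : Matrix M N R) :
    (A * B).det = ∑ f : N → M, (∏ i, B (f i) i) * (A.submatrix id f).det := by
  have h : (A * B).transpose = fun i => ∑ j, B j i • A.transpose j := by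
    ext i k
    simp [Matrix.mul_apply, mul_comm]
  rw [← Matrix.det_transpose, h]
  refine (Matrix.detRowAlternating.toMultilinearMap.map_sum _).trans
    (Finset.sum_congr rfl fun f _ => ?_)
  refine (Matrix.detRowAlternating.toMultilinearMap.map_smul_univ _ _).trans ?_
  rw [smul_eq_mul, ← Matrix.det_transpose (A.submatrix id f)]
  rfl

theorem det_mul_mem_minorsIdeal {R N M : Type*} [CommRing R] [Fintype N] [DecidableEq N]
    [Fintype M] {t : ℕ} (e : Fin t ≃ N) (A : Matrix N M R) (B : Matrix M N R) :
    (A * B).det ∈ minorsIdeal t A := by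
  rw [Matrix.det_mul_eq_sum_prod_mul_det]
  refine sum_mem fun f _ => Ideal.mul_mem_left _ _ (Ideal.subset_span ⟨e, f ∘ e, ?_⟩)
  rw [← Matrix.det_submatrix_equiv_self e, Matrix.submatrix_submatrix]
  rfl

theorem map_minorsIdeal_le {R S N M : Type*} [CommRing R] [CommRing S] (f : R →+* S) (t : ℕ)
    (A : Matrix N M R) : (minorsIdeal t A).map f ≤ minorsIdeal t (A.map f) := by
  rw [minorsIdeal, Ideal.map_span, Ideal.span_le]
  rintro _ ⟨_, ⟨r, c, rfl⟩, rfl⟩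
  refine Ideal.subset_span ⟨r, c, ?_⟩
  rw [RingHom.map_det]
  rfl

/-- An enumeration of the `d`-element subsets of `Fin n`. -/
def equivFinsetCard (n d : ℕ) : Fin (n.choose d) ≃ {s : Finset (Fin n) // s.card = d} :=
  (Fintype.equivFinOfCardEq (by simp)).symm

theorem det_submatrix_pow_mem_minorsIdeal {R : Type*} [CommRing R] {m n d : ℕ} (hd : 1 ≤ d)
    (φ : Matrix (Fin n) (Fin m) R) (c : Fin n → Fin m) :
    (φ.submatrix id c).det ^ (n - 1).choose (d - 1) ∈
      minorsIdeal (n.choose d) (extPowMatrix d φ) := by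
  have h : φ.submatrix id c = φ * (1 : Matrix (Fin m) (Fin m) R).submatrix id c := by
    ext i j
    simp [Matrix.mul_apply, Matrix.one_apply]
  rw [← det_extPowMatrix hd, h, extPowMatrix_mul]
  exact det_mul_mem_minorsIdeal (equivFinsetCard n d) _ _

theorem minorsIdeal_pow_subset_intClosure {R : Type*} [CommRing R] {m n d : ℕ} (hd : 1 ≤ d)
    (hdn : d ≤ n) (φ : Matrix (Fin n) (Fin m) R) :
    (minorsIdeal n φ ^ (n - 1).choose (d - 1)).intClosure ⊆
      (minorsIdeal (n.choose d) (extPowMatrix d φ)).intClosure := by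
  rw [minorsIdeal_eq_span_range (Equiv.refl _) φ, Ideal.span, Submodule.span_pow]
  refine Ideal.intClosure_span_subset fun x hx => ?_
  obtain ⟨f, hf, rfl⟩ := Set.mem_pow_iff_prod.1 hx
  refine Ideal.mem_intClosure_of_pow_mem (k := (n - 1).choose (d - 1))
    (Nat.choose_pos (by omega)) ?_
  rw [← Finset.prod_pow]
  have := Ideal.prod_mem_prod (s := Finset.univ) (x := fun i => f i ^ (n - 1).choose (d - 1))
    (I := fun _ => minorsIdeal (n.choose d) (extPowMatrix d φ)) fun i _ => by
      obtain ⟨c, hc⟩ := hf i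
      dsimp only at hc ⊢
      rw [← hc]
      exact det_submatrix_pow_mem_minorsIdeal hd φ c
  simpa using this

/-- Cramer's rule for the columns of `φ` with respect to a maximal square submatrix. -/
theorem submatrix_mul_adjugate_mul {R : Type*} [CommRing R] {m n : ℕ}
    (φ : Matrix (Fin n) (Fin m) R) (c : Fin n → Fin m) :
    φ.submatrix id c * ((φ.submatrix id c).adjugate * φ) = (φ.submatrix id c).det • φ := by
  rw [← Matrix.mul_assoc, Matrix.mul_adjugate, Matrix.smul_mul, Matrix.one_mul]

theorem adjugate_mul_apply_mem_minorsIdeal {R : Type*} [CommRing R] {m n : ℕ}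
    (φ : Matrix (Fin n) (Fin m) R) (c : Fin n → Fin m) (i : Fin n) (j : Fin m) :
    ((φ.submatrix id c).adjugate * φ) i j ∈ minorsIdeal n φ := by
  refine Ideal.subset_span ⟨id, Function.update c i j, ?_⟩
  have h : ((φ.submatrix id c).adjugate * φ) i j =
      ((φ.submatrix id c).adjugate.mulVec (φ.col j)) i := rfl
  rw [h, ← Matrix.cramer_eq_adjugate_mulVec, Matrix.cramer_apply]
  congr 1
  ext a b
  by_cases hb : b = i
  · subst hb; simp
  · simp [hb]

theorem det_pow_mul_det_extPowMatrix_mem {R : Type*} [CommRing R] {m n d : ℕ} (hd : 1 ≤ d)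
    (φ : Matrix (Fin n) (Fin m) R) (c : Fin n → Fin m)
    (t : Fin (n.choose d) → {s : Finset (Fin m) // s.card = d}) :
    (φ.submatrix id c).det ^ (d * n.choose d) *
      ((extPowMatrix d φ).submatrix (equivFinsetCard n d) t).det ∈
      minorsIdeal n φ ^ ((n - 1).choose (d - 1) + d * n.choose d) := by
  set Δ := (φ.submatrix id c).det with hΔ
  set ψ := (φ.submatrix id c).adjugate * φ
  set e := equivFinsetCard n d
  have hψ : φ.submatrix id c * ψ = Δ • φ := submatrix_mul_adjugate_mul φ c
  have h := congrArg (fun A => ((extPowMatrix d A).submatrix e t).det) hψ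
  simp only [extPowMatrix_smul, extPowMatrix_mul, ← Matrix.submatrix_mul_equiv _ _ e e t,
    Matrix.det_mul, Matrix.det_submatrix_equiv_self, det_extPowMatrix hd, Matrix.submatrix_smul,
    Pi.smul_apply, Matrix.det_smul, Fintype.card_fin, ← pow_mul, ← hΔ] at h
  rw [← h, pow_add]
  have hΔI : Δ ∈ minorsIdeal n φ := Ideal.subset_span ⟨id, c, rfl⟩
  refine Ideal.mul_mem_mul (Ideal.pow_mem_pow hΔI _) ?_
  rw [pow_mul]
  have hent (i j) : extPowMatrix d ψ (e i) (t j) ∈ minorsIdeal n φ ^ d := by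
    have := Matrix.det_mem_ideal_pow (I := minorsIdeal n φ)
      (A := ψ.submatrix ((e i).1.orderEmbOfFin (e i).2) ((t j).1.orderEmbOfFin (t j).2))
      fun a b => adjugate_mul_apply_mem_minorsIdeal φ c _ _
    rwa [Fintype.card_fin] at this
  have := Matrix.det_mem_ideal_pow (A := (extPowMatrix d ψ).submatrix e t) hent
  rwa [Fintype.card_fin] at this

theorem Ideal.mul_mem_pow_add_of_forall_pow_mul_mem {R ι : Type*} [CommRing R] [Fintype ι]
    [Nonempty ι] {g : ι → R} {I : Ideal R} (hI : I = Ideal.span (Set.range g)) {y : R} {k M : ℕ}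
    (h : ∀ i, g i ^ M * y ∈ I ^ (k + M)) {z : R} (hz : z ∈ I ^ (Fintype.card ι * M)) :
    y * z ∈ I ^ k * I ^ (Fintype.card ι * M) := by
  classical
  have hg : ∀ i, g i ∈ I := fun i => hI ▸ Ideal.subset_span ⟨i, rfl⟩
  nth_rw 1 [hI] at hz
  rw [Ideal.span, Submodule.span_pow] at hz
  induction hz using Submodule.span_induction with
  | zero => simp
  | add a b _ _ ha hb => exact mul_add y a b ▸ add_mem ha hb
  | smul a b _ hb =>
    rw [smul_eq_mul, mul_left_comm]
    exact Ideal.mul_mem_left _ _ hb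
  | mem z hzz =>
    obtain ⟨f, hf, rfl⟩ := Set.mem_pow_iff_prod.1 hzz
    choose u hu using hf
    obtain ⟨i, hi⟩ := Fintype.exists_le_card_fiber_of_mul_le_card u
      (n := M) (by simp)
    obtain ⟨s, hs, hsM⟩ := Finset.exists_subset_card_eq hi
    have hsplit : y * ∏ a, f a = (g i ^ M * y) * ∏ a ∈ sᶜ, f a := by
      rw [← Finset.prod_mul_prod_compl s f, Finset.prod_congr rfl
        (fun a ha => show f a = g i by rw [← hu, (Finset.mem_filter.1 (hs ha)).2]),
        Finset.prod_const, hsM]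
      ring
    have hc : ∏ a ∈ sᶜ, f a ∈ I ^ (Fintype.card ι * M - M) := by
      have := Ideal.prod_mem_prod (s := sᶜ) (x := f) (I := fun _ => I) fun a _ => hu a ▸ hg (u a)
      simpa [Finset.card_compl, hsM] using this
    rw [hsplit]
    have := Ideal.mul_mem_mul (h i) hc
    have hM : M ≤ Fintype.card ι * M := Nat.le_mul_of_pos_left _ Fintype.card_pos
    rwa [← pow_add, add_assoc, Nat.add_sub_cancel' hM, pow_add] at this

theorem Nat.choose_lt_choose_of_lt {m n d : ℕ} (hd : 1 ≤ d) (hdn : d ≤ n) (hmn : m < n) :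
    m.choose d < n.choose d := by
  obtain h | h := lt_or_ge m d
  · rw [Nat.choose_eq_zero_of_lt h]
    exact Nat.choose_pos hdn
  · refine lt_of_lt_of_le ?_ (Nat.choose_le_choose d hmn)
    obtain ⟨d, rfl⟩ := Nat.exists_eq_add_of_le' hd
    rw [Nat.choose_succ_succ']
    have := Nat.choose_pos (show d ≤ m by omega)
    omega

theorem det_submatrix_extPowMatrix_mem_intClosure {R : Type*} [CommRing R] {m n d : ℕ} (hd : 1 ≤ d)
    (hdn : d ≤ n) (φ : Matrix (Fin n) (Fin m) R)
    (t : Fin (n.choose d) → {s : Finset (Fin m) // s.card = d}) :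
    ((extPowMatrix d φ).submatrix (equivFinsetCard n d) t).det ∈
      (minorsIdeal n φ ^ (n - 1).choose (d - 1)).intClosure := by
  obtain hmn | hmn := lt_or_ge m n
  · obtain ⟨i, j, hij, ht⟩ := Fintype.exists_ne_map_eq_of_card_lt t (by
      simpa using Nat.choose_lt_choose_of_lt hd hdn hmn)
    rw [Matrix.det_zero_of_column_eq hij fun k => by simp [ht]]
    exact Ideal.mem_intClosure_of_pow_mem one_pos (by simp)
  let P := MvPolynomial (Fin n × Fin m) ℤ
  let X : Matrix (Fin n) (Fin m) P := Matrix.mvPolynomialX _ _ ℤ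
  let f : P →+* R := (MvPolynomial.aeval fun p : Fin n × Fin m => φ p.1 p.2).toRingHom
  have hf : X.map f = φ := by
    ext i j
    exact MvPolynomial.aeval_X _ _
  let c₀ : Fin n → Fin m := Fin.castLE hmn
  have hX : (X.submatrix id c₀).det ≠ 0 := by
    let g : P →+* ℤ := (MvPolynomial.aeval fun p : Fin n × Fin m =>
      if c₀ p.1 = p.2 then (1 : ℤ) else 0).toRingHom
    have hg : (X.submatrix id c₀).map g = 1 := by
      ext i j
      refine (MvPolynomial.aeval_X _ _).trans ?_
      simp [Matrix.one_apply, c₀, (Fin.castLE_injective hmn).eq_iff]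
    intro h
    have := congrArg g h
    rw [RingHom.map_det, RingHom.mapMatrix_apply, hg] at this
    simp at this
  have hI0 : minorsIdeal n X ≠ ⊥ := fun h =>
    hX ((Submodule.eq_bot_iff _).1 h _ (Ideal.subset_span ⟨id, c₀, rfl⟩))
  have : Nonempty (Fin n → Fin m) := ⟨c₀⟩
  have hspan := minorsIdeal_eq_span_range (Equiv.refl _) X
  have hfg : (minorsIdeal n X).FG := by
    rw [hspan]
    exact Submodule.fg_span (Set.finite_range _)
  have key : ((extPowMatrix d X).submatrix (equivFinsetCard n d) t).det ∈
      (minorsIdeal n X ^ (n - 1).choose (d - 1)).intClosure :=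
    Ideal.mem_intClosure_of_mul_mem (hfg.pow (n := Fintype.card (Fin n → Fin m) * (d * n.choose d)))
      (pow_ne_zero _ hI0)
      fun z hz => Ideal.mul_mem_pow_add_of_forall_pow_mul_mem hspan
        (fun c => det_pow_mul_det_extPowMatrix_mem hd X c t) hz
  have := Ideal.map_mem_intClosure f
    (J := minorsIdeal n φ ^ (n - 1).choose (d - 1)) (by
      rw [Ideal.map_pow]
      refine Ideal.pow_right_mono ?_ _
      simpa only [hf] using map_minorsIdeal_le f n X) key
  rwa [RingHom.map_det, RingHom.mapMatrix_apply, ← Matrix.submatrix_map, ← extPowMatrix_map, hf]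
    at this

/-- For a commutative ring `R`, a linear map `φ : R^m → R^n` and `1 ≤ d ≤ n`, the ideals
`I(⋀^d(φ))` and `I(φ)^e`, `e = (n - 1).choose (d - 1)`, have the same integral closure. -/
theorem intClosure_maximalMinors_extPow {R : Type*} [CommRing R] {m n : ℕ}
    (φ : Matrix (Fin n) (Fin m) R) (d : ℕ) (hd : 1 ≤ d) (hdn : d ≤ n) :
    (minorsIdeal (n.choose d) (extPowMatrix d φ)).intClosure =
      (minorsIdeal n φ ^ ((n - 1).choose (d - 1))).intClosure := by
  refine Set.Subset.antisymm ?_ (minorsIdeal_pow_subset_intClosure hd hdn φ)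
  rw [minorsIdeal_eq_span_range (equivFinsetCard n d)]
  refine Ideal.intClosure_span_subset ?_
  rintro _ ⟨t, rfl⟩
  exact det_submatrix_extPowMatrix_mem_intClosure hd hdn φ t
end
end
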